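/- Let X ∈ B be an evolutionary PDE of the form X = ε f(u)u_x + Σ_{i≥3} ε^i X_i with f'(u) ≠ 0 and X_i ∈ R homogeneous of degree i. Then there exists a unique Y ∈ B̃ of the form Y = Σ_{i≥2} ε^i Y_i, with Y_i ∈ R̃ homogeneous of degree i, such that g_Y(X) = ε f(u)u_x. Moreover, any other reducing transformation g_Z (Z ∈ B̃) with g_Z(X) = ε f(u)u_x can be represented as g_{Ỹ} ∘ g_Y where Ỹ = ε p(u)u_x for an arbitrary smooth function p. -/

import Mathlib

open scoped BigOperators ContDiff

set_option maxHeartbeats 1000000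
set_option synthInstance.maxHeartbeats 1000000

noncomputable section

attribute [local instance] Classical.propDecidable

/-! ### The coefficient ring `C^∞(u₀)` : smooth functions on an open set `s ⊆ ℝ` -/

def SF (s : Set ℝ) : Subalgebra ℝ (ℝ → ℝ) where
  carrier := {f | ContDiffOn ℝ ∞ f s}
  mul_mem' hf hg := hf.mul hg
  add_mem' hf hg := hf.add hg
  algebraMap_mem' c := contDiffOn_const

/-- derivative (within `s`) of a smooth function, extended by `0` outside `s`. -/
def dSF (s : Set ℝ) (hs : IsOpen s) (f : SF s) : SF s :=
  ⟨fun x => if x ∈ s then derivWithin (f : ℝ → ℝ) s x else 0, by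
    have h1 : ContDiffOn ℝ ∞ (derivWithin (f : ℝ → ℝ) s) s :=
      f.2.derivWithin hs.uniqueDiffOn (by exact_mod_cast le_refl _)
    exact h1.congr fun x hx => if_pos hx⟩

/-! ### The ambient ring of (generalized) differential polynomials.

A monomial exponent `(z, b, l) : Mon` stands for
`u₁^z * ∏ₖ u_{k+2}^(b k) * (log u₁)^l`, and an element of `Rl s` is a finite
`C^∞(u₀)`-linear combination of such monomials.  Ordinary differential polynomials,
almost differential polynomials, etc. are carved out by predicates below. -/

abbrev Mon : Type := ℤ × (ℕ →₀ ℕ) × ℕ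

abbrev Rl (s : Set ℝ) := AddMonoidAlgebra (SF s) Mon

variable (s : Set ℝ)

/-- embedding of a smooth function of `u₀` as a differential polynomial -/
def CF (c : SF s) : Rl s := AddMonoidAlgebra.single (0, 0, 0) c

/-- the function `u₀ ↦ u₀` -/
def idSF : SF s := ⟨fun x => x, contDiffOn_id⟩

/-- the jet variable `u_ℓ = ∂ₓ^ℓ u` as an element of `Rl s` -/
def uVar : ℕ → Rl s
  | 0 => AddMonoidAlgebra.single (0, 0, 0) (idSF s)
  | 1 => AddMonoidAlgebra.single (1, 0, 0) 1
  | (k+2) => AddMonoidAlgebra.single (0, Finsupp.single k 1, 0) 1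

/-- `log u₁` as an element of `Rl s` -/
def logUx : Rl s := AddMonoidAlgebra.single (0, 0, 1) 1

variable (hs : IsOpen s)

/-- the partial derivative `∂/∂u_i` on `Rl s` -/
def pd (i : ℕ) (p : Rl s) : Rl s :=
  match i with
  | 0 => Finsupp.sum p.coeff fun m c => AddMonoidAlgebra.single m (dSF s hs c)
  | 1 => Finsupp.sum p.coeff fun m c =>
      AddMonoidAlgebra.single (m.1 - 1, m.2.1, m.2.2) (m.1 • c)
      + AddMonoidAlgebra.single (m.1 - 1, m.2.1, m.2.2 - 1) (m.2.2 • c)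
  | (j+2) => Finsupp.sum p.coeff fun m c =>
      AddMonoidAlgebra.single (m.1, m.2.1 - Finsupp.single j 1, m.2.2) ((m.2.1 j) • c)

/-- the total `x`-derivative `∂ₓ = ∑ᵢ u_{i+1} ∂/∂uᵢ` -/
def dx (p : Rl s) : Rl s := ∑ᶠ i, uVar s (i+1) * pd s hs i p

/-- the variational derivative `δ/δu = ∑ᵢ (-∂ₓ)^i ∘ ∂/∂uᵢ` -/
def varDer (p : Rl s) : Rl s := ∑ᶠ i, (-1 : Rl s)^i * (dx s hs)^[i] (pd s hs i p)

/-- `X̂(p) = ∑ᵢ ∂ₓ^i(x) · ∂p/∂uᵢ`, the evolutionary vector field generated by `x` -/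
def XhatR (x p : Rl s) : Rl s := ∑ᶠ i, (dx s hs)^[i] x * pd s hs i p

/-! ### ε-series -/

/-- an `ε`-power series with coefficients in `Rl s`; `a n` is the coefficient of `ε^n`. -/
abbrev Ser := ℕ → Rl s

def mulSer (a b : Ser s) : Ser s := fun n => ∑ k ∈ Finset.range (n+1), a k * b (n-k)

def XhatSer (X f : Ser s) : Ser s :=
  fun n => ∑ k ∈ Finset.range (n+1), XhatR s hs (X k) (f (n-k))

/-- the Lie bracket `[X,Y] = X̂(Y) - Ŷ(X)` on vector fields -/
def brk (X Y : Ser s) : Ser s := fun n => XhatSer s hs X Y n - XhatSer s hs Y X n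

def varDerSer (f : Ser s) : Ser s := fun n => varDer s hs (f n)

def dxSer (f : Ser s) : Ser s := fun n => dx s hs (f n)

/-- multiplication by `ε` -/
def shiftEps (a : Ser s) : Ser s := fun n => match n with | 0 => 0 | m+1 => a m

/-! ### gradings and the various subspaces -/

/-- total degree of a monomial, where `deg u_ℓ = ℓ`, `deg (log u₁) = 0`. -/
def wtM (m : Mon) : ℤ := m.1 + (m.2.1.sum fun k e => ((k:ℤ)+2) * e)

/-- homogeneous of degree `d` -/
def IsHomog (d : ℤ) (p : Rl s) : Prop := ∀ m ∈ p.coeff.support, wtM m = d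

def NoLog (p : Rl s) : Prop := ∀ m ∈ p.coeff.support, m.2.2 = 0

/-- `p` is a genuine differential polynomial, i.e. `p ∈ R = C^∞(u₀)[u₁, u₂, …]` -/
def InR (p : Rl s) : Prop := NoLog s p ∧ ∀ m ∈ p.coeff.support, 0 ≤ m.1

/-- `p` is an almost differential polynomial, i.e.
`p ∈ R̃ = C^∞(u₀)[u₁, u₂/u₁², u₃/u₁³, …]` -/
def InRt (p : Rl s) : Prop := NoLog s p ∧ ∀ m ∈ p.coeff.support, 0 ≤ wtM m

/-- `p` depends only on `u, uₓ, …, u⁽ᴺ⁾` -/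
def UsesVarsLe (N : ℕ) (p : Rl s) : Prop :=
  ∀ m ∈ p.coeff.support, (m.1 ≠ 0 → 1 ≤ N) ∧ ∀ k, m.2.1 k ≠ 0 → k + 2 ≤ N

/-- membership in `𝒜 = {∑_{i≥0} εⁱ fᵢ | fᵢ ∈ R, deg fᵢ = i}` -/
def InA (a : Ser s) : Prop := ∀ i, InR s (a i) ∧ IsHomog s i (a i)

/-- membership in `ℬ = {∑_{i≥1} εⁱ fᵢ | fᵢ ∈ R, deg fᵢ = i}` -/
def InB (a : Ser s) : Prop := InA s a ∧ a 0 = 0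

def InAt (a : Ser s) : Prop := ∀ i, InRt s (a i) ∧ IsHomog s i (a i)

/-- membership in `ℬ̃` (almost differential polynomial vector fields) -/
def InBt (a : Ser s) : Prop := InAt s a ∧ a 0 = 0

/-! ### local functionals -/

/-- the subspace `∂ₓ(·) ⊕ ℝ` by which densities are quotiented; `Pr` singles out the
class of densities used (`InA` for `Λ`, `InAt` for `Λ̃`). -/
def LamSub (Pr : Ser s → Prop) : Submodule ℝ (Ser s) :=
  Submodule.span ℝ
    ({a | ∃ b : Ser s, Pr b ∧ a = fun n => dx s hs (b n)} ∪
     {a | ∃ c : ℝ, a = fun n => if n = 0 then algebraMap ℝ (Rl s) c else 0})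

instance serHasQuotient : HasQuotient (Ser s) (Submodule ℝ (Ser s)) :=
  Submodule.hasQuotient (R := ℝ) (M := Ser s)

/-- the space of local functionals `Λ = 𝒜/(∂ₓ𝒜 ⊕ ℝ)` (resp. `Λ̃`). -/
abbrev Lam (Pr : Ser s → Prop) := (Ser s) ⧸ LamSub s hs Pr

instance lamAddCommGroup (Pr : Ser s → Prop) : AddCommGroup (Lam s hs Pr) :=
  Submodule.Quotient.addCommGroup _

instance lamModule (Pr : Ser s → Prop) : Module ℝ (Lam s hs Pr) :=
  Submodule.Quotient.module _

/-- the local functional `∫ f dx` with density `f` -/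
def intdx (Pr : Ser s → Prop) (f : Ser s) : Lam s hs Pr := Submodule.Quotient.mk f

/-! ### differential operators -/

/-- a differential operator `∑_{n,j} εⁿ P n j ∂ₓ^j`. -/
abbrev Op := ℕ → ℕ → Rl s

/-- membership in `𝒟 = {∑_{k≥0} ε^k ∑_{s=0}^{k+1} P_{k,s} ∂ₓ^{k+1-s} | P_{k,s} ∈ R, deg P_{k,s} = s}` -/
def InD (P : Op s) : Prop :=
  ∀ n j, (n+1 < j → P n j = 0) ∧
    (j ≤ n+1 → InR s (P n j) ∧ IsHomog s ((n:ℤ)+1-j) (P n j))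

/-- same, with almost differential polynomial coefficients (`𝒟̃`). -/
def InDt (P : Op s) : Prop :=
  ∀ n j, (n+1 < j → P n j = 0) ∧
    (j ≤ n+1 → InRt s (P n j) ∧ IsHomog s ((n:ℤ)+1-j) (P n j))

/-- application of an operator to an `ε`-series -/
def appOp (P : Op s) (a : Ser s) : Ser s :=
  fun n => ∑ k ∈ Finset.range (n+1), ∑ᶠ j, P k j * (dx s hs)^[j] (a (n-k))

/-- composition (product) of differential operators -/
def compOp (P Q : Op s) : Op s :=
  fun n j => ∑ k ∈ Finset.range (n+1), ∑ᶠ i, ∑ᶠ l, ∑ r ∈ Finset.range (i+1),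
    if i - r + l = j then (i.choose r : Rl s) * P k i * (dx s hs)^[r] (Q (n-k) l) else 0

/-- the density `(δF/δu) · P(δG/δu)` of the Poisson bracket `{F,G}_P` -/
def pbDen (P : Op s) (f g : Ser s) : Ser s :=
  mulSer s (varDerSer s hs f) (appOp s hs P (varDerSer s hs g))

/-- `P ∈ 𝒟` is a Hamiltonian operator:  `{F,G}_P = ∫ (δF/δu) P (δG/δu) dx` is a
Lie bracket on `Λ` (skew-symmetric and satisfying the Jacobi identity). -/
def IsHamOp (P : Op s) : Prop :=
  InD s P ∧
  (∀ f g : Ser s, InA s f → InA s g →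
      intdx s hs (InA s) (pbDen s hs P f g) + intdx s hs (InA s) (pbDen s hs P g f) = 0) ∧
  (∀ f g h : Ser s, InA s f → InA s g → InA s h →
      intdx s hs (InA s) (pbDen s hs P (pbDen s hs P f g) h)
    + intdx s hs (InA s) (pbDen s hs P (pbDen s hs P g h) f)
    + intdx s hs (InA s) (pbDen s hs P (pbDen s hs P h f) g) = 0)

/-- the operator `∑ₖ (∂X/∂uₖ)·∂ₓ^k` -/
def opL (X : Ser s) : Op s := fun n k => pd s hs k (X n)

/-- the operator `∑ₖ (-∂ₓ)^k ∘ (∂X/∂uₖ ·)`, written in normal form -/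
def opR (X : Ser s) : Op s := fun n j =>
  ∑ᶠ k, if j ≤ k then
    (-1 : Rl s)^k * (k.choose (k-j) : Rl s) * (dx s hs)^[k-j] (pd s hs k (X n)) else 0

/-- the Lie derivative `Lie_X P` of an operator along an evolutionary vector field,
given by formula (2.7) of the paper:
`Lie_X P = ∑_s X̂(P_s)∂ₓ^s - ∑ₖ ((∂X/∂uₖ)·∂ₓ^k·P + P·(-∂ₓ)^k·(∂X/∂uₖ))`. -/
def LieOp (X : Ser s) (P : Op s) : Op s := fun n j =>
  (∑ k ∈ Finset.range (n+1), XhatR s hs (X k) (P (n-k) j))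
  - compOp s hs (opL s hs X) P n j - compOp s hs P (opR s hs X) n j

/-! ### Miura / quasi-Miura transformations `g_Y = e^{ad_Y}` -/

/-- action of `g_Y = e^{ad_Y}` on vector fields (`ad_Y X = [Y,X]`);
the sum may be truncated at order `m = n` since `Y` has no `ε⁰`-term. -/
def gV (Y X : Ser s) : Ser s :=
  fun n => ∑ m ∈ Finset.range (n+1), ((m.factorial : ℝ)⁻¹) • ((brk s hs Y)^[m] X n)

/-- action of `g_Y = e^{ad_Y}` on operators (`ad_Y P = Lie_Y P`) -/
def gOp (Y : Ser s) (P : Op s) : Op s :=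
  fun n j => ∑ m ∈ Finset.range (n+1), ((m.factorial : ℝ)⁻¹) • ((LieOp s hs Y)^[m] P n j)

/-- action of `g_Y = e^{ad_Y}` on local functionals, at the level of densities
(`ad_Y F = Y.F = ∫ Ŷ(f) dx`) -/
def gF (Y f : Ser s) : Ser s :=
  fun n => ∑ m ∈ Finset.range (n+1), ((m.factorial : ℝ)⁻¹) • ((XhatSer s hs Y)^[m] f n)

/-! ### some particular elements -/

/-- the hydrodynamic Hamiltonian operator `g(u)∂ₓ + ½ g'(u)uₓ` -/
def hydroOp (g : SF s) : Op s := fun n j =>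
  if n = 0 ∧ j = 1 then CF s g
  else if n = 0 ∧ j = 0 then (1/2 : ℝ) • (CF s (dSF s hs g) * uVar s 1) else 0

/-- the differential polynomial `f(u)·uₓ` -/
def fux (f : SF s) : Rl s := CF s f * uVar s 1

/-- the vector field `ε f(u) uₓ` -/
def bfield (f : SF s) : Ser s := fun n => if n = 1 then fux s f else 0

/-- the series `u` itself (at order `ε⁰`) -/
def uSer : Ser s := fun n => if n = 0 then uVar s 0 else 0

def onesSer : Ser s := fun n => if n = 0 then 1 else 0

def serPow (a : Ser s) : ℕ → Ser s
  | 0 => onesSer s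
  | (j+1) => mulSer s a (serPow a j)

def iterDSF : ℕ → SF s → SF s
  | 0, f => f
  | (j+1), f => dSF s hs (iterDSF j f)

/-- substitution of an `ε`-series `v = u + O(ε)` into a smooth function `f`,
via the Taylor expansion `f(v) = ∑ⱼ f⁽ʲ⁾(u)(v-u)ʲ/j!`. -/
def fSubst (f : SF s) (v : Ser s) : Ser s := fun n =>
  ∑ j ∈ Finset.range (n+1), ((j.factorial : ℝ)⁻¹) •
    (mulSer s (fun m => if m = 0 then CF s (iterDSF s hs j f) else 0)
      (serPow s (fun m => v m - uSer s m) j)) n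

/-- the multiplication operator by `q ∈ Rl s` -/
def multOp (q : Rl s) : Op s := fun n j => if n = 0 ∧ j = 0 then q else 0

/-- the operator `∂ₓ` -/
def dxOp : Op s := fun n j => if n = 0 ∧ j = 1 then 1 else 0


/-! ## Setting for this statement -/

abbrev S : Set ℝ := Set.univ

lemma hS : IsOpen S := isOpen_univ

/-- the evolutionary PDE `X = ε f(u)uₓ + ∑_{i≥3} εⁱ Xᵢ ∈ ℬ` -/
def evX (f : SF S) (Xi : ℕ → Rl S) : Ser S :=
  fun n => if n = 1 then fux S f else if 3 ≤ n then Xi n else 0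

set_option maxHeartbeats 1000000
set_option synthInstance.maxHeartbeats 1000000
set_option linter.all false

theorem dSF_apply (f : SF S) (x : ℝ) : (dSF S hS f : ℝ → ℝ) x = deriv (f : ℝ → ℝ) x := by
  simp [dSF]

theorem SF_diff (f : SF S) (x : ℝ) : DifferentiableAt ℝ (f : ℝ → ℝ) x := by
  have h : ContDiffOn ℝ ∞ (f : ℝ → ℝ) Set.univ := f.2
  rw [contDiffOn_univ] at h
  exact (h.differentiable (by simp)) x

theorem dSF_add (f g : SF S) : dSF S hS (f + g) = dSF S hS f + dSF S hS g := by
  ext x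
  simp only [dSF_apply, Subalgebra.coe_add, Pi.add_apply]
  exact deriv_add (SF_diff f x) (SF_diff g x)

theorem dSF_mul (f g : SF S) : dSF S hS (f * g) = dSF S hS f * g + f * dSF S hS g := by
  ext x
  simp only [dSF_apply, Subalgebra.coe_add, Pi.add_apply, Subalgebra.coe_mul, Pi.mul_apply]
  exact deriv_mul (SF_diff f x) (SF_diff g x)

theorem dSF_smul (r : ℝ) (f : SF S) : dSF S hS (r • f) = r • dSF S hS f := by
  ext x
  simp only [dSF_apply, Subalgebra.coe_smul, Pi.smul_apply]
  exact deriv_const_smul r (SF_diff f x)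

theorem dSF_zero : dSF S hS 0 = 0 := by
  have := dSF_smul 0 0
  simpa using this

theorem dSF_one : dSF S hS 1 = 0 := by
  ext x
  simp [dSF_apply]

theorem dSF_id : dSF S hS (idSF S) = 1 := by
  ext x
  simp [dSF_apply, idSF]

theorem pd_add (i : ℕ) (p q : Rl S) : pd S hS i (p + q) = pd S hS i p + pd S hS i q := by
  match i with
  | 0 =>
    simp only [pd, AddMonoidAlgebra.coeff_add]
    exact Finsupp.sum_add_index' (by simp [dSF_zero]) (by simp [dSF_add])
  | 1 =>
    simp only [pd, AddMonoidAlgebra.coeff_add]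
    exact Finsupp.sum_add_index' (by simp) (by intros; simp; abel)
  | (j+2) =>
    simp only [pd, AddMonoidAlgebra.coeff_add]
    exact Finsupp.sum_add_index' (by simp) (by simp)

theorem pd0_single (m : Mon) (c : SF S) : pd S hS 0 (AddMonoidAlgebra.single m c)
    = AddMonoidAlgebra.single m (dSF S hS c) := by
  simp only [pd, AddMonoidAlgebra.coeff_single]
  rw [Finsupp.sum_single_index]
  simp [dSF_zero]

theorem pd1_single (m : Mon) (c : SF S) : pd S hS 1 (AddMonoidAlgebra.single m c)
    = AddMonoidAlgebra.single (m.1 - 1, m.2.1, m.2.2) (m.1 • c)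
      + AddMonoidAlgebra.single (m.1 - 1, m.2.1, m.2.2 - 1) (m.2.2 • c) := by
  simp only [pd, AddMonoidAlgebra.coeff_single]
  rw [Finsupp.sum_single_index]
  simp

theorem pd2_single (j : ℕ) (m : Mon) (c : SF S) : pd S hS (j+2) (AddMonoidAlgebra.single m c)
    = AddMonoidAlgebra.single (m.1, m.2.1 - Finsupp.single j 1, m.2.2) ((m.2.1 j) • c) := by
  simp only [pd, AddMonoidAlgebra.coeff_single]
  rw [Finsupp.sum_single_index]
  simp

theorem pd_zero (i : ℕ) : pd S hS i 0 = 0 := by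
  have := pd_add i 0 0
  simpa using this

theorem pd_smul (i : ℕ) (r : ℝ) (p : Rl S) : pd S hS i (r • p) = r • pd S hS i p := by
  induction p using AddMonoidAlgebra.induction_linear with
  | zero => simp [pd_zero]
  | add p q hp hq => simp only [smul_add, pd_add, hp, hq]
  | single m c =>
    rw [AddMonoidAlgebra.smul_single]
    match i with
    | 0 => simp only [pd0_single, dSF_smul, AddMonoidAlgebra.smul_single]
    | 1 => simp only [pd1_single, AddMonoidAlgebra.smul_single, smul_add, smul_comm r]
    | (j+2) => simp only [pd2_single, AddMonoidAlgebra.smul_single, smul_comm r]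

theorem single_congr_mon {m m' : Mon} {c c' : SF S} (h : c ≠ 0 → m = m') (h2 : c = c') :
    AddMonoidAlgebra.single m c = AddMonoidAlgebra.single m' c' := by
  subst h2
  by_cases hc : c = 0
  · simp [hc]
  · rw [h hc]

theorem pd_leibniz_single (i : ℕ) (m m' : Mon) (c c' : SF S) :
    pd S hS i (AddMonoidAlgebra.single m c * AddMonoidAlgebra.single m' c')
      = AddMonoidAlgebra.single m c * pd S hS i (AddMonoidAlgebra.single m' c')
       + AddMonoidAlgebra.single m' c' * pd S hS i (AddMonoidAlgebra.single m c) := by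
  rw [AddMonoidAlgebra.single_mul_single]
  obtain ⟨z, b, l⟩ := m
  obtain ⟨z', b', l'⟩ := m'
  match i with
  | 0 =>
    simp only [pd0_single, AddMonoidAlgebra.single_mul_single]
    rw [add_comm (z', b', l'), ← AddMonoidAlgebra.single_add, dSF_mul]
    congr 1; ring
  | 1 =>
    simp only [pd1_single, AddMonoidAlgebra.single_mul_single, mul_add]
    rw [add_add_add_comm]
    congr 1
    · have e1 : ((z, b, l) : Mon) + (z' - 1, b', l')
          = ((((z, b, l) : Mon) + (z', b', l')).1 - 1, (((z, b, l) : Mon) + (z', b', l')).2.1,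
            (((z, b, l) : Mon) + (z', b', l')).2.2) := by
        ext <;> simp; ring
      have e2 : ((z', b', l') : Mon) + (z - 1, b, l)
          = ((((z, b, l) : Mon) + (z', b', l')).1 - 1, (((z, b, l) : Mon) + (z', b', l')).2.1,
            (((z, b, l) : Mon) + (z', b', l')).2.2) := by
        ext <;> simp <;> ring
      rw [e1, e2, ← AddMonoidAlgebra.single_add]
      congr 1
      simp only [Prod.fst_add, zsmul_eq_mul]
      push_cast; ring
    · have e1 : AddMonoidAlgebra.single (((z, b, l) : Mon) + (z' - 1, b', l' - 1)) (c * l' • c')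
          = AddMonoidAlgebra.single ((((z, b, l) : Mon) + (z', b', l')).1 - 1,
            (((z, b, l) : Mon) + (z', b', l')).2.1,
            (((z, b, l) : Mon) + (z', b', l')).2.2 - 1) (c * l' • c') := by
        apply single_congr_mon _ rfl
        intro h
        have : l' ≠ 0 := by rintro rfl; simp at h
        ext <;> simp
        · ring
        · omega
      have e2 : AddMonoidAlgebra.single (((z', b', l') : Mon) + (z - 1, b, l - 1)) (c' * l • c)
          = AddMonoidAlgebra.single ((((z, b, l) : Mon) + (z', b', l')).1 - 1,
            (((z, b, l) : Mon) + (z', b', l')).2.1,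
            (((z, b, l) : Mon) + (z', b', l')).2.2 - 1) (c' * l • c) := by
        apply single_congr_mon _ rfl
        intro h
        have : l ≠ 0 := by rintro rfl; simp at h
        ext <;> simp
        · ring
        · ring
        · omega
      rw [e1, e2, ← AddMonoidAlgebra.single_add]
      congr 1
      simp only [Prod.snd_add, nsmul_eq_mul]
      push_cast; ring
  | (j+2) =>
    simp only [pd2_single, AddMonoidAlgebra.single_mul_single]
    have e1 : AddMonoidAlgebra.single (((z, b, l) : Mon) + (z', b' - Finsupp.single j 1, l'))
          (c * b' j • c')
          = AddMonoidAlgebra.single ((((z, b, l) : Mon) + (z', b', l')).1,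
            (((z, b, l) : Mon) + (z', b', l')).2.1 - Finsupp.single j 1,
            (((z, b, l) : Mon) + (z', b', l')).2.2) (c * b' j • c') := by
      apply single_congr_mon _ rfl
      intro h
      have : b' j ≠ 0 := by intro h0; simp [h0] at h
      ext k <;> simp
      by_cases hk : j = k
      · subst hk; simp; omega
      · simp [Finsupp.single_apply, hk]
    have e2 : AddMonoidAlgebra.single (((z', b', l') : Mon) + (z, b - Finsupp.single j 1, l))
          (c' * b j • c)
          = AddMonoidAlgebra.single ((((z, b, l) : Mon) + (z', b', l')).1,
            (((z, b, l) : Mon) + (z', b', l')).2.1 - Finsupp.single j 1,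
            (((z, b, l) : Mon) + (z', b', l')).2.2) (c' * b j • c) := by
      apply single_congr_mon _ rfl
      intro h
      have : b j ≠ 0 := by intro h0; simp [h0] at h
      ext k <;> simp
      · ring
      · by_cases hk : j = k
        · subst hk; simp; omega
        · simp [Finsupp.single_apply, hk]; ring
      · ring
    rw [e1, e2, ← AddMonoidAlgebra.single_add]
    congr 1
    simp only [Prod.snd_add, Prod.fst_add, Finsupp.add_apply, nsmul_eq_mul]
    push_cast; ring

theorem pd_leibniz (i : ℕ) (p q : Rl S) :
    pd S hS i (p * q) = p * pd S hS i q + q * pd S hS i p := by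
  induction p using AddMonoidAlgebra.induction_linear with
  | zero => simp [pd_zero]
  | add p p' hp hp' => simp only [add_mul, mul_add, pd_add, hp, hp']; ring
  | single m c =>
    induction q using AddMonoidAlgebra.induction_linear with
    | zero => simp [pd_zero]
    | add p p' hp hp' => simp only [add_mul, mul_add, pd_add, hp, hp']; ring
    | single m' c' => exact pd_leibniz_single i m m' c c'

/-- bundled partial derivative -/
def PD (i : ℕ) : Derivation ℝ (Rl S) (Rl S) :=
  Derivation.mk' { toFun := pd S hS i, map_add' := pd_add i, map_smul' := pd_smul i }
    (fun a b => by simpa using pd_leibniz i a b)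

theorem PD_apply (i : ℕ) (p : Rl S) : PD i p = pd S hS i p := rfl

theorem pd_comm (i j : ℕ) (p : Rl S) : PD i (PD j p) = PD j (PD i p) := by
  simp only [PD_apply]
  wlog hij : i ≤ j generalizing i j
  · exact (this j i (by omega)).symm
  induction p using AddMonoidAlgebra.induction_linear with
  | zero => simp [pd_zero]
  | add p p' hp hp' => simp only [pd_add, hp, hp']
  | single m c =>
    match i, j with
    | 0, 0 => rfl
    | 0, 1 => 
      simp only [pd0_single, pd1_single, pd_add]
      simp only [← Nat.cast_smul_eq_nsmul ℝ, ← Int.cast_smul_eq_zsmul ℝ, dSF_smul]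
    | 0, (j+2) => 
      simp only [pd0_single, pd2_single]
      simp only [← Nat.cast_smul_eq_nsmul ℝ, dSF_smul]
    | 1, 1 => rfl
    | 1, (j+2) => 
      simp only [pd1_single, pd2_single, pd_add]
      simp only [smul_comm (m.2.1 j)]
    | (i+2), (j+2) => 
      simp only [pd2_single]
      by_cases h : i = j
      · subst h; rfl
      · simp only [Finsupp.coe_tsub, Pi.sub_apply, Finsupp.single_apply, h, Ne.symm h, if_false,
          Nat.sub_zero, smul_comm (m.2.1 j)]
        rw [tsub_right_comm]

theorem pd_bound (p : Rl S) : ∃ N, ∀ i, N ≤ i → PD i p = 0 := by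
  simp only [PD_apply]
  induction p using AddMonoidAlgebra.induction_linear with
  | zero => exact ⟨0, fun i _ => pd_zero i⟩
  | add p q hp hq =>
    obtain ⟨N, hN⟩ := hp
    obtain ⟨M, hM⟩ := hq
    refine ⟨max N M, fun i hi => ?_⟩
    rw [pd_add, hN i (le_trans (le_max_left _ _) hi), hM i (le_trans (le_max_right _ _) hi),
      add_zero]
  | single m c =>
    obtain ⟨N, hN⟩ := m.2.1.support.exists_nat_subset_range
    refine ⟨N + 2, fun i hi => ?_⟩
    obtain ⟨j, rfl⟩ : ∃ j, i = j + 2 := ⟨i - 2, by omega⟩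
    rw [pd2_single]
    have : m.2.1 j = 0 := by
      by_contra h
      have := hN (Finsupp.mem_support_iff.mpr h)
      simp at this
      omega
    simp [this]

theorem DVsum_eq (v : ℕ → Rl S) (p : Rl S) (N : ℕ) (hN : ∀ i, N ≤ i → PD i p = 0) :
    ∑ᶠ i, v i * pd S hS i p = ∑ i ∈ Finset.range N, v i * pd S hS i p := by
  apply finsum_eq_sum_of_support_subset
  intro i hi
  simp only [Finset.coe_range, Set.mem_Iio]
  by_contra h
  apply hi
  have := hN i (by omega)
  rw [PD_apply] at this
  simp [this]

/-- the vector field with components `v` -/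
def DV (v : ℕ → Rl S) : Derivation ℝ (Rl S) (Rl S) :=
  Derivation.mk' { toFun := fun p => ∑ᶠ i, v i * pd S hS i p
                   map_add' := fun p q => by
                    obtain ⟨N, hN⟩ := pd_bound p
                    obtain ⟨M, hM⟩ := pd_bound q
                    rw [DVsum_eq v p (max N M) (fun i hi => hN i (le_trans (le_max_left _ _) hi)),
                      DVsum_eq v q (max N M) (fun i hi => hM i (le_trans (le_max_right _ _) hi)),
                      DVsum_eq v (p+q) (max N M) (fun i hi => by
                        rw [map_add, hN i (le_trans (le_max_left _ _) hi),
                          hM i (le_trans (le_max_right _ _) hi), add_zero]),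
                      ← Finset.sum_add_distrib]
                    refine Finset.sum_congr rfl fun i _ => ?_
                    rw [pd_add, mul_add]
                   map_smul' := fun r p => by
                    obtain ⟨N, hN⟩ := pd_bound p
                    rw [DVsum_eq v p N hN, DVsum_eq v (r • p) N (fun i hi => by
                      rw [Derivation.map_smul, hN i hi, smul_zero]), RingHom.id_apply, Finset.smul_sum]
                    refine Finset.sum_congr rfl fun i _ => ?_
                    rw [pd_smul, mul_smul_comm] }
    (fun p q => by
      obtain ⟨N, hN⟩ := pd_bound p
      obtain ⟨M, hM⟩ := pd_bound q
      simp only [LinearMap.coe_mk, AddHom.coe_mk]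
      rw [DVsum_eq v p (max N M) (fun i hi => hN i (le_trans (le_max_left _ _) hi)),
        DVsum_eq v q (max N M) (fun i hi => hM i (le_trans (le_max_right _ _) hi)),
        DVsum_eq v (p*q) (max N M) (fun i hi => by
          rw [Derivation.leibniz, hN i (le_trans (le_max_left _ _) hi),
            hM i (le_trans (le_max_right _ _) hi), smul_zero, smul_zero, add_zero]),
        smul_eq_mul, smul_eq_mul, Finset.mul_sum, Finset.mul_sum, ← Finset.sum_add_distrib]
      refine Finset.sum_congr rfl fun i _ => ?_
      rw [pd_leibniz]; ring)

theorem DV_apply (v : ℕ → Rl S) (p : Rl S) : DV v p = ∑ᶠ i, v i * pd S hS i p := rfl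

theorem DV_sum (v : ℕ → Rl S) (p : Rl S) (N : ℕ) (hN : ∀ i, N ≤ i → PD i p = 0) :
    DV v p = ∑ i ∈ Finset.range N, v i * PD i p := DVsum_eq v p N hN

theorem DV_exists_sum (p : Rl S) : ∃ N, ∀ v, DV v p = ∑ i ∈ Finset.range N, v i * PD i p := by
  obtain ⟨N, hN⟩ := pd_bound p
  exact ⟨N, fun v => DV_sum v p N hN⟩

theorem PD_uVar (i j : ℕ) : PD i (uVar S j) = if i = j then 1 else 0 := by
  rw [PD_apply]
  match i, j with
  | 0, 0 => simp [uVar, pd0_single, dSF_id, AddMonoidAlgebra.one_def]; rfl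
  | 0, 1 => simp [uVar, pd0_single, dSF_one]
  | 0, (j+2) => simp [uVar, pd0_single, dSF_one]
  | 1, 0 => simp [uVar, pd1_single]
  | 1, 1 => simp [uVar, pd1_single, AddMonoidAlgebra.one_def]; rfl
  | 1, (j+2) => simp [uVar, pd1_single]
  | (i+2), 0 => simp [uVar, pd2_single]
  | (i+2), 1 => simp [uVar, pd2_single]
  | (i+2), (j+2) =>
    by_cases h : i = j
    · subst h; simp [uVar, pd2_single, AddMonoidAlgebra.one_def]; rfl
    · simp [uVar, pd2_single, Finsupp.single_apply, h, Ne.symm h]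

/-- `H` depends on `u_i` only -/
def Only (i : ℕ) (H : Rl S) : Prop := ∀ k, k ≠ i → PD k H = 0

theorem Only.pd {i : ℕ} {H : Rl S} (h : Only i H) : Only i (PD i H) := fun k hk => by
  rw [pd_comm, h k hk, map_zero]

theorem Only_uVar (i : ℕ) : Only i (uVar S i) := fun k hk => by
  rw [PD_uVar, if_neg hk]

theorem DV_only (v : ℕ → Rl S) (i : ℕ) (H : Rl S) (h : Only i H) : DV v H = v i * PD i H := by
  rw [DV_apply, finsum_eq_single _ i]
  · rfl
  · intro k hk
    have := h k hk
    rw [PD_apply] at this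
    rw [this, mul_zero]

theorem DV_uVar (v : ℕ → Rl S) (i : ℕ) : DV v (uVar S i) = v i := by
  rw [DV_only v i _ (Only_uVar i), PD_uVar, if_pos rfl, mul_one]

/-- derivations compatible with the chain rule in each variable -/
def IsLocalDer (δ : Rl S → Rl S) : Prop := ∀ i H, Only i H → δ H = δ (uVar S i) * PD i H

theorem DV_local (v : ℕ → Rl S) : IsLocalDer (DV v) := fun i H h => by
  rw [DV_only v i H h, DV_uVar]

theorem Only_CF (c : SF S) : Only 0 (CF S c) := fun k hk => by
  match k with
  | 0 => exact absurd rfl hk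
  | 1 => simp [PD_apply, CF, pd1_single]
  | (k+2) => simp [PD_apply, CF, pd2_single]

theorem Only_one_single (z : ℤ) (l : ℕ) :
    Only 1 (AddMonoidAlgebra.single ((z, 0, l) : Mon) (1 : SF S)) := fun k hk => by
  match k with
  | 0 => simp [PD_apply, pd0_single, dSF_one]
  | 1 => exact absurd rfl hk
  | (k+2) => simp [PD_apply, pd2_single]

theorem Only_two_single (j e : ℕ) :
    Only (j+2) (AddMonoidAlgebra.single ((0, Finsupp.single j e, 0) : Mon) (1 : SF S)) :=
  fun k hk => by
  match k with
  | 0 => simp [PD_apply, pd0_single, dSF_one]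
  | 1 => simp [PD_apply, pd1_single]
  | (k+2) =>
    have : j ≠ k := fun h => hk (by omega)
    simp [PD_apply, pd2_single, Finsupp.single_apply, this]

theorem ext_local (δ δ' : Derivation ℝ (Rl S) (Rl S)) (h : IsLocalDer δ) (h' : IsLocalDer δ')
    (hu : ∀ i, δ (uVar S i) = δ' (uVar S i)) : δ = δ' := by
  have key : ∀ i H, Only i H → δ H = δ' H := fun i H hH => by rw [h i H hH, h' i H hH, hu]
  have hm : ∀ a b, δ a = δ' a → δ b = δ' b → δ (a * b) = δ' (a * b) := fun a b ha hb => by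
    rw [Derivation.leibniz, Derivation.leibniz, ha, hb]
  refine Derivation.ext fun p => ?_
  induction p using AddMonoidAlgebra.induction_linear with
  | zero => simp
  | add p q hp hq => rw [map_add, map_add, hp, hq]
  | single m c =>
    obtain ⟨z, b, l⟩ := m
    have e : AddMonoidAlgebra.single ((z, b, l) : Mon) c
        = CF S c * AddMonoidAlgebra.single ((z, 0, l) : Mon) (1 : SF S)
          * AddMonoidAlgebra.single ((0, b, 0) : Mon) (1 : SF S) := by
      simp [CF, AddMonoidAlgebra.single_mul_single]
    rw [e]
    refine hm _ _ (hm _ _ (key 0 _ (Only_CF c)) (key 1 _ (Only_one_single z l))) ?_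
    induction b using Finsupp.induction_linear with
    | zero =>
      have : AddMonoidAlgebra.single ((0, 0, 0) : Mon) (1 : SF S) = 1 := rfl
      rw [this]; simp
    | add b b' hb hb' =>
      have : AddMonoidAlgebra.single ((0, b + b', 0) : Mon) (1 : SF S)
        = AddMonoidAlgebra.single ((0, b, 0) : Mon) (1 : SF S)
         * AddMonoidAlgebra.single ((0, b', 0) : Mon) (1 : SF S) := by
        simp [AddMonoidAlgebra.single_mul_single]
      rw [this]
      exact hm _ _ (hb (by simp [CF, AddMonoidAlgebra.single_mul_single]))
        (hb' (by simp [CF, AddMonoidAlgebra.single_mul_single]))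
    | single j n => exact key _ _ (Only_two_single j n)

/-- commutator of derivations -/
def DB (δ δ' : Derivation ℝ (Rl S) (Rl S)) : Derivation ℝ (Rl S) (Rl S) :=
  Derivation.mk' { toFun := fun p => δ (δ' p) - δ' (δ p)
                   map_add' := fun p q => by simp only [map_add]; ring
                   map_smul' := fun r p => by
                    simp only [Derivation.map_smul, RingHom.id_apply, smul_sub] }
    (fun p q => by
      simp only [LinearMap.coe_mk, AddHom.coe_mk, Derivation.leibniz, map_add, smul_eq_mul]
      ring)

theorem DB_apply (δ δ' : Derivation ℝ (Rl S) (Rl S)) (p : Rl S) :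
    DB δ δ' p = δ (δ' p) - δ' (δ p) := rfl

instance instRingEndRl : Ring (Module.End ℝ (Rl S)) := Module.End.instRing (R := ℝ) (N₁ := Rl S)

theorem End_sub_apply (a b : Module.End ℝ (Rl S)) (p : Rl S) : (a - b) p = a p - b p := rfl

theorem bracket_local (δ δ' : Derivation ℝ (Rl S) (Rl S)) (h : IsLocalDer δ) (h' : IsLocalDer δ') :
    IsLocalDer (DB (δ) (δ')) := fun i H hH => by
  rw [DB_apply, DB_apply, h i H hH, h' i H hH,
    Derivation.leibniz, Derivation.leibniz, h i _ hH.pd, h' i _ hH.pd]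
  simp only [smul_eq_mul]
  ring

/-- total derivative -/
def dxD : Derivation ℝ (Rl S) (Rl S) := DV (fun i => uVar S (i+1))

theorem dxD_apply (p : Rl S) : dx S hS p = dxD p := rfl

theorem dx_coe : dx S hS = dxD := rfl

theorem dxD_uVar (i : ℕ) : dxD (uVar S i) = uVar S (i+1) := DV_uVar _ i

/-- evolutionary vector field -/
def XH (x : Rl S) : Derivation ℝ (Rl S) (Rl S) := DV (fun i => dxD^[i] x)

theorem XhatR_eq (x p : Rl S) : XhatR S hS x p = XH x p := rfl

theorem XH_u0 (x : Rl S) : XH x (uVar S 0) = x := DV_uVar _ 0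

theorem XH_local (x : Rl S) : IsLocalDer (XH x) := DV_local _

theorem eq_XH (δ : Derivation ℝ (Rl S) (Rl S)) (h : IsLocalDer δ)
    (hc : ∀ p, δ (dxD p) = dxD (δ p)) : δ = XH (δ (uVar S 0)) := by
  refine ext_local _ _ h (XH_local _) fun i => ?_
  rw [XH, DV_uVar]
  induction i with
  | zero => rfl
  | succ i ih => rw [Function.iterate_succ_apply', ← ih, ← dxD_uVar, hc]

theorem XH_dx (x p : Rl S) : XH x (dxD p) = dxD (XH x p) := by
  have : (DB (XH x) (dxD)) = 0 := by
    refine ext_local _ _ (bracket_local _ _ (XH_local _) (DV_local _)) ?_ fun i => ?_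
    · intro i H _; simp
    · rw [DB_apply, dxD_uVar, XH, DV_uVar, DV_uVar,
        Function.iterate_succ_apply']
      simp
  have h2 := congrArg (fun d : Derivation ℝ (Rl S) (Rl S) => d p) this
  simp only [DB_apply, Derivation.coe_zero, Pi.zero_apply] at h2
  exact sub_eq_zero.mp h2

theorem XH_bracket (x y : Rl S) :
    (DB (XH x) (XH y)) = XH (XH x y - XH y x) := by
  have := eq_XH (DB (XH x) (XH y)) (bracket_local _ _ (XH_local _) (XH_local _)) (fun p => by
    rw [DB_apply, DB_apply, XH_dx, XH_dx, XH_dx, XH_dx,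
      map_sub])
  rw [this, DB_apply, XH_u0, XH_u0]

theorem dxD_iter_add (i : ℕ) (x y : Rl S) : dxD^[i] (x + y) = dxD^[i] x + dxD^[i] y :=
  iterate_map_add dxD i x y

theorem dxD_iter_smul (i : ℕ) (r : ℝ) (x : Rl S) : dxD^[i] (r • x) = r • dxD^[i] x := by
  induction i with
  | zero => rfl
  | succ i ih => rw [Function.iterate_succ_apply', Function.iterate_succ_apply', ih, Derivation.map_smul]

theorem DV_add (v w : ℕ → Rl S) : DV (v + w) = DV v + DV w := by
  refine Derivation.ext fun p => ?_
  obtain ⟨N, hN⟩ := DV_exists_sum p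
  simp only [Derivation.coe_add, Pi.add_apply, hN, add_mul, Finset.sum_add_distrib]

theorem DV_smul (r : ℝ) (v : ℕ → Rl S) : DV (r • v) = r • DV v := by
  refine Derivation.ext fun p => ?_
  obtain ⟨N, hN⟩ := DV_exists_sum p
  simp only [Derivation.coe_smul, Pi.smul_apply, hN, Finset.smul_sum, smul_mul_assoc]

/-- evolutionary vector fields, as a linear map to operators -/
def XHL : Rl S →ₗ[ℝ] Module.End ℝ (Rl S) where
  toFun x := (XH x : Rl S →ₗ[ℝ] Rl S)
  map_add' x y := by
    have : XH (x + y) = XH x + XH y := by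
      rw [XH, XH, XH, ← DV_add]
      congr 1; funext i; exact dxD_iter_add i x y
    rw [this]; rfl
  map_smul' r x := by
    have : XH (r • x) = r • XH x := by
      rw [XH, XH, ← DV_smul]
      congr 1; funext i; exact dxD_iter_smul i r x
    rw [this]; rfl

theorem XHL_apply (x p : Rl S) : XHL x p = XH x p := rfl

theorem XHL_inj {x y : Rl S} (h : XHL x = XHL y) : x = y := by
  have := congrArg (fun e : Module.End ℝ (Rl S) => e (uVar S 0)) h
  simpa only [XHL_apply, XH_u0] using this

/-- bracket of single vector fields -/
def br (x y : Rl S) : Rl S := XHL x y - XHL y x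

theorem XHL_br (x y : Rl S) : XHL (br x y) = XHL x * XHL y - XHL y * XHL x := by
  refine LinearMap.ext fun p => ?_
  have h := congrArg (fun d : Derivation ℝ (Rl S) (Rl S) => d p) (XH_bracket x y)
  simp only [DB_apply] at h
  exact h.symm

/-- elements supported on monomials satisfying `P` -/
def SupM (P : Mon → Prop) : Submodule ℝ (Rl S) where
  carrier := {p | ∀ m, p.coeff m ≠ 0 → P m}
  zero_mem' := fun m h => absurd rfl h
  add_mem' := fun {a b} ha hb m h => by
    by_cases h1 : a.coeff m = 0
    · apply hb m
      intro h2
      apply h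
      rw [AddMonoidAlgebra.coeff_add, Finsupp.add_apply, h1, h2, add_zero]
    · exact ha m h1
  smul_mem' := fun r a ha m h => by
    apply ha m
    intro h2
    apply h
    rw [AddMonoidAlgebra.coeff_smul, Finsupp.smul_apply, h2, smul_zero]

theorem mem_SupM {P : Mon → Prop} {p : Rl S} : p ∈ SupM P ↔ ∀ m, p.coeff m ≠ 0 → P m := Iff.rfl

theorem SupM_sub {P : Mon → Prop} {p q : Rl S} (hp : p ∈ SupM P) (hq : q ∈ SupM P) :
    p - q ∈ SupM P := by
  intro m h
  by_contra hm
  have h1 : p.coeff m = 0 := by by_contra h1; exact hm (hp m h1)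
  have h2 : q.coeff m = 0 := by by_contra h2; exact hm (hq m h2)
  apply h
  have h3 := congrArg (fun r : Rl S => r.coeff m) (sub_add_cancel p q)
  simp only [AddMonoidAlgebra.coeff_add, Finsupp.add_apply, h1, h2, add_zero] at h3
  exact h3

theorem SupM_mono {P Q : Mon → Prop} (h : ∀ m, P m → Q m) {p : Rl S} (hp : p ∈ SupM P) :
    p ∈ SupM Q := fun m hm => h m (hp m hm)

theorem single_mem_SupM {P : Mon → Prop} {m : Mon} (c : SF S) (h : c ≠ 0 → P m) :
    (AddMonoidAlgebra.single m c : Rl S) ∈ SupM P := by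
  intro m' hm'
  rw [AddMonoidAlgebra.coeff_single, Finsupp.single_apply] at hm'
  split_ifs at hm' with h1
  · subst h1; exact h hm'
  · exact absurd rfl hm'

theorem SupM_induction {P : Mon → Prop} {motive : Rl S → Prop} {p : Rl S} (hp : p ∈ SupM P)
    (zero : motive 0) (add : ∀ p q, motive p → motive q → motive (p + q))
    (single : ∀ m c, P m → motive (AddMonoidAlgebra.single m c)) : motive p := by
  rw [← AddMonoidAlgebra.sum_coeff_single p, Finsupp.sum]
  refine Finset.sum_induction _ motive add zero fun m hm => ?_
  exact single _ _ (hp m (Finsupp.mem_support_iff.mp hm))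

theorem SupM_map {P Q : Mon → Prop} (δ : Derivation ℝ (Rl S) (Rl S))
    (h : ∀ m c, P m → δ (AddMonoidAlgebra.single m c) ∈ SupM Q) {p : Rl S} (hp : p ∈ SupM P) :
    δ p ∈ SupM Q := by
  refine SupM_induction (motive := fun p => δ p ∈ SupM Q) hp ?_ ?_ ?_
  · rw [map_zero]; exact Submodule.zero_mem _
  · intro p q hp hq; rw [map_add]; exact Submodule.add_mem _ hp hq
  · exact h

theorem SupM_mul {P Q T : Mon → Prop} (h : ∀ m n, P m → Q n → T (m + n)) {p q : Rl S}
    (hp : p ∈ SupM P) (hq : q ∈ SupM Q) : p * q ∈ SupM T := by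
  refine SupM_induction (motive := fun p => p * q ∈ SupM T) hp ?_ ?_ ?_
  · rw [zero_mul]; exact Submodule.zero_mem _
  · intro p q hp hq; rw [add_mul]; exact Submodule.add_mem _ hp hq
  · intro m c hm
    refine SupM_induction (motive := fun q => AddMonoidAlgebra.single m c * q ∈ SupM T) hq ?_ ?_ ?_
    · rw [mul_zero]; exact Submodule.zero_mem _
    · intro p q hp hq; rw [mul_add]; exact Submodule.add_mem _ hp hq
    · intro n c' hn
      rw [AddMonoidAlgebra.single_mul_single]
      exact single_mem_SupM _ fun _ => h m n hm hn

theorem wtM_add (m n : Mon) : wtM (m + n) = wtM m + wtM n := by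
  simp only [wtM, Prod.fst_add, Prod.snd_add]
  rw [Finsupp.sum_add_index' (by simp) (by intros; push_cast; ring)]
  ring

/-- quadratic weight -/
def qw (m : Mon) : ℕ := m.2.1.sum fun k e => (k+1)^2 * e

theorem qw_add (m n : Mon) : qw (m + n) = qw m + qw n := by
  simp only [qw, Prod.fst_add, Prod.snd_add]
  rw [Finsupp.sum_add_index' (by simp) (by intros; ring)]

/-- eigenvalue -/
def nu (m : Mon) : ℤ := m.1 + m.2.1.sum fun k e => ((k:ℤ)+3) * e

theorem nu_add (m n : Mon) : nu (m + n) = nu m + nu n := by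
  simp only [nu, Prod.fst_add, Prod.snd_add]
  rw [Finsupp.sum_add_index' (by simp) (by intros; push_cast; ring)]
  ring

theorem mon_split (m : Mon) (j : ℕ) (h : m.2.1 j ≠ 0) :
    m = (m.1, m.2.1 - Finsupp.single j 1, m.2.2) + (0, Finsupp.single j 1, 0) := by
  ext k <;> simp
  by_cases hk : j = k
  · subst hk; simp; omega
  · simp [Finsupp.single_apply, hk]

theorem wtM_e (j : ℕ) : wtM (0, Finsupp.single j 1, 0) = j + 2 := by
  simp [wtM]

theorem qw_e (j : ℕ) : qw (0, Finsupp.single j 1, 0) = (j+1)^2 := by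
  simp [qw]

theorem wtM_z (z : ℤ) : wtM (z, 0, 0) = z := by simp [wtM]

theorem qw_z (z : ℤ) : qw (z, 0, 0) = 0 := by simp [qw]

/-- homogeneous elements without logarithms -/
def Good (d : ℤ) : Submodule ℝ (Rl S) := SupM fun m => m.2.2 = 0 ∧ wtM m = d

theorem Good_mul {d e : ℤ} {p q : Rl S} (hp : p ∈ Good d) (hq : q ∈ Good e) :
    p * q ∈ Good (d + e) :=
  SupM_mul (fun m n hm hn => ⟨by simp [hm.1, hn.1], by rw [wtM_add, hm.2, hn.2]⟩) hp hq

theorem Good_CF (c : SF S) : CF S c ∈ Good 0 :=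
  single_mem_SupM c fun _ => ⟨rfl, wtM_z 0⟩

theorem Good_uVar (i : ℕ) : uVar S i ∈ Good i := by
  match i with
  | 0 => exact single_mem_SupM _ fun _ => ⟨rfl, wtM_z 0⟩
  | 1 => exact single_mem_SupM _ fun _ => ⟨rfl, wtM_z 1⟩
  | (j+2) => exact single_mem_SupM _ fun _ => ⟨rfl, wtM_e j⟩

theorem wtM_sub1 (m : Mon) : wtM (m.1 - 1, m.2.1, m.2.2) = wtM m - 1 := by
  simp [wtM]; ring

theorem qw_sub1 (z : ℤ) (l : ℕ) (m : Mon) : qw (z, m.2.1, l) = qw m := rfl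

theorem Good_PD {d : ℤ} (i : ℕ) {p : Rl S} (hp : p ∈ Good d) : PD i p ∈ Good (d - i) := by
  refine SupM_map (PD i) ?_ hp
  rintro m c ⟨h1, h2⟩
  rw [PD_apply]
  match i with
  | 0 =>
    rw [pd0_single]
    exact single_mem_SupM _ fun _ => ⟨h1, by simp [h2]⟩
  | 1 =>
    rw [pd1_single]
    refine Submodule.add_mem _ (single_mem_SupM _ fun _ => ⟨h1, ?_⟩)
      (single_mem_SupM _ fun h => absurd ?_ h)
    · rw [wtM_sub1, h2]; rfl
    · rw [h1, zero_smul]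
  | (j+2) =>
    rw [pd2_single]
    refine single_mem_SupM _ fun h => ⟨h1, ?_⟩
    have hj : m.2.1 j ≠ 0 := by intro h0; rw [h0, zero_smul] at h; exact h rfl
    have := mon_split m j hj
    rw [this, wtM_add, wtM_e] at h2
    push_cast
    linarith

theorem Good_DV {d e : ℤ} {v : ℕ → Rl S} (hv : ∀ i : ℕ, v i ∈ Good (e + i)) {p : Rl S}
    (hp : p ∈ Good d) : DV v p ∈ Good (e + d) := by
  obtain ⟨N, hN⟩ := DV_exists_sum p
  rw [hN]
  refine Submodule.sum_mem _ fun i _ => ?_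
  have := Good_mul (hv i) (Good_PD i hp)
  rwa [show e + i + (d - i) = e + d by ring] at this

theorem Good_dxD {d : ℤ} {p : Rl S} (hp : p ∈ Good d) : dxD p ∈ Good (1 + d) := by
  refine Good_DV (fun i => ?_) hp
  have := Good_uVar (i+1)
  rwa [show ((i + 1 : ℕ) : ℤ) = 1 + i by push_cast; ring] at this

theorem Good_dxD_iter {d : ℤ} {p : Rl S} (hp : p ∈ Good d) (i : ℕ) :
    dxD^[i] p ∈ Good (d + i) := by
  induction i with
  | zero => simpa using hp
  | succ i ih =>
    rw [Function.iterate_succ_apply']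
    have := Good_dxD ih
    rwa [show 1 + (d + i) = d + ((i + 1 : ℕ) : ℤ) by push_cast; ring] at this

theorem Good_XHL {d e : ℤ} {x p : Rl S} (hx : x ∈ Good e) (hp : p ∈ Good d) :
    XHL x p ∈ Good (e + d) :=
  Good_DV (fun i => Good_dxD_iter hx i) hp

theorem Good_br {d e : ℤ} {x y : Rl S} (hx : x ∈ Good e) (hy : y ∈ Good d) :
    br x y ∈ Good (e + d) := by
  have h2 := Good_XHL hy hx
  rw [add_comm] at h2
  exact SupM_sub (Good_XHL hx hy) h2

theorem DV_mul (a : Rl S) (v : ℕ → Rl S) (p : Rl S) :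
    DV (fun i => a * v i) p = a * DV v p := by
  obtain ⟨N, hN⟩ := DV_exists_sum p
  rw [hN, hN, Finset.mul_sum]
  exact Finset.sum_congr rfl fun i _ => by ring

theorem DV_sub (v w : ℕ → Rl S) (p : Rl S) :
    DV (fun i => v i - w i) p = DV v p - DV w p := by
  obtain ⟨N, hN⟩ := DV_exists_sum p
  rw [eq_sub_iff_add_eq, hN, hN, hN, ← Finset.sum_add_distrib]
  exact Finset.sum_congr rfl fun i _ => by ring

theorem PD0_CF (f : SF S) : PD 0 (CF S f) = CF S (dSF S hS f) := pd0_single _ _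

theorem dxD_CF (f : SF S) : dxD (CF S f) = uVar S 1 * CF S (dSF S hS f) := by
  rw [dxD, DV_only _ 0 _ (Only_CF f), PD0_CF]

/-- the non-transport part of the linearised flow -/
def QQ (f : SF S) (i : ℕ) : Rl S := dxD^[i] (fux S f) - CF S f * uVar S (i+1)

theorem br_eq (f : SF S) (y : Rl S) :
    br y (fux S f) = CF S (dSF S hS f) * uVar S 1 * y - DV (QQ f) y := by
  have h1 : DV (QQ f) y = XH (fux S f) y - CF S f * dxD y := by
    have : QQ f = fun i => dxD^[i] (fux S f) - CF S f * uVar S (i+1) := rfl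
    rw [this, DV_sub, DV_mul]; rfl
  rw [h1, br, XHL_apply, XHL_apply]
  have h2 : XH y (fux S f) = CF S f * dxD y + uVar S 1 * (y * CF S (dSF S hS f)) := by
    rw [fux, Derivation.leibniz, XH_local y 0 _ (Only_CF f), XH_u0, PD0_CF, ← dxD_uVar 0, XH_dx,
      XH_u0]
    rfl
  rw [h2]; ring

theorem QQ_zero (f : SF S) : QQ f 0 = 0 := by simp [QQ, fux]

theorem QQ_succ (f : SF S) (i : ℕ) :
    QQ f (i+1) = dxD (QQ f i) + CF S (dSF S hS f) * uVar S 1 * uVar S (i+1) := by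
  rw [QQ, QQ, map_sub, Derivation.leibniz, dxD_CF, dxD_uVar, Function.iterate_succ_apply']
  simp only [smul_eq_mul]; ring

theorem br_fux (p f : SF S) : br (fux S p) (fux S f) = 0 := by
  rw [br_eq]
  have : DV (QQ f) (fux S p) = CF S p * QQ f 1 := by
    rw [fux, Derivation.leibniz, DV_uVar, DV_only _ 0 _ (Only_CF p), QQ_zero]; simp
  rw [this, QQ_succ, QQ_zero, map_zero, fux]; ring

/-- diagonal coefficients -/
def kap : ℕ → ℤ
  | 0 => 0
  | 1 => 1
  | (k+2) => k + 3

/-- lower-order part -/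
def RR (f : SF S) (i : ℕ) : Rl S :=
  QQ f i - CF S (dSF S hS f) * uVar S 1 * ((kap i : Rl S) * uVar S i)

theorem RR_zero (f : SF S) : RR f 0 = 0 := by simp [RR, QQ_zero, kap]

theorem RR_one (f : SF S) : RR f 1 = 0 := by
  simp [RR, QQ_succ, QQ_zero, kap]

theorem RR_two (f : SF S) :
    RR f 2 = CF S (dSF S hS (dSF S hS f)) * (uVar S 1 * (uVar S 1 * uVar S 1)) := by
  rw [RR, QQ_succ, QQ_succ, QQ_zero, map_zero, zero_add, Derivation.leibniz, Derivation.leibniz,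
    dxD_CF, dxD_uVar]
  simp only [smul_eq_mul, kap]
  push_cast; ring

theorem dxD_int (z : ℤ) : dxD (z : Rl S) = 0 := by
  have h : (z : Rl S) = algebraMap ℝ (Rl S) (z : ℝ) := (map_intCast _ z).symm
  rw [h]
  exact Derivation.map_algebraMap _ _

theorem RR_succ (f : SF S) (k : ℕ) :
    RR f (k+3) = ((k + 3 : ℤ) : Rl S) * (CF S (dSF S hS (dSF S hS f)) * (uVar S 1 * (uVar S 1 * uVar S (k+2)))
       + CF S (dSF S hS f) * (uVar S 2 * uVar S (k+2))) + dxD (RR f (k+2)) := by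
  rw [RR, QQ_succ, RR, map_sub]
  simp only [Derivation.leibniz, dxD_CF, dxD_uVar, dxD_int, smul_eq_mul, kap]
  push_cast; ring

theorem int_mul' (z : ℤ) (x : Rl S) : (z : Rl S) * x = (z : ℝ) • x := by
  have h : (z : Rl S) = algebraMap ℝ (Rl S) (z : ℝ) := (map_intCast _ z).symm
  rw [h, Algebra.smul_def]

theorem uVar1_mul (m : Mon) (c : SF S) : uVar S 1 * AddMonoidAlgebra.single m c
    = AddMonoidAlgebra.single ((1,0,0) + m) c := by
  rw [uVar, AddMonoidAlgebra.single_mul_single, one_mul]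

theorem uVar2_mul (j : ℕ) (m : Mon) (c : SF S) : uVar S (j+2) * AddMonoidAlgebra.single m c
    = AddMonoidAlgebra.single ((0,Finsupp.single j 1,0) + m) c := by
  rw [uVar, AddMonoidAlgebra.single_mul_single, one_mul]

/-- support condition for the lower-order terms -/
def LowP (k : ℕ) (m : Mon) : Prop :=
  m.2.2 = 0 ∧ wtM m = k + 3 ∧ qw m < (k+1)^2 ∧ ∀ j, k ≤ j → m.2.1 j = 0

theorem LowP_dx (k : ℕ) (m : Mon) (c : SF S) (h : LowP k m) :
    dxD (AddMonoidAlgebra.single m c) ∈ SupM (LowP (k+1)) := by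
  obtain ⟨N, hN⟩ := DV_exists_sum (AddMonoidAlgebra.single m c)
  rw [dxD, hN]
  obtain ⟨h1, h2, h3, h4⟩ := h
  refine Submodule.sum_mem _ fun i _ => ?_
  rw [PD_apply]
  match i with
  | 0 =>
    rw [pd0_single, uVar1_mul]
    refine single_mem_SupM _ fun _ => ⟨by simp [h1], ?_, ?_, fun j hj => ?_⟩
    · rw [wtM_add, wtM_z, h2]; push_cast; ring
    · rw [qw_add, qw_z]; nlinarith
    · simp [h4 j (by omega)]
  | 1 =>
    rw [pd1_single, mul_add, uVar2_mul, uVar2_mul, h1]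
    refine Submodule.add_mem _ (single_mem_SupM _ fun _ => ⟨by simp, ?_, ?_, fun j hj => ?_⟩)
      (single_mem_SupM _ fun h => absurd (zero_smul _ _) h)
    · have := wtM_sub1 m
      rw [h1] at this
      rw [wtM_add, wtM_e, this, h2]; push_cast; ring
    · rw [qw_add, qw_e, qw_sub1]; nlinarith
    · have := h4 j (by omega)
      have h0 : j ≠ 0 := by omega
      simp [this, h0]
  | (j+2) =>
    rw [pd2_single, uVar2_mul]
    refine single_mem_SupM _ fun hc => ?_
    have hj : m.2.1 j ≠ 0 := by intro h0; rw [h0, zero_smul] at hc; exact hc rfl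
    have hjk : j < k := by by_contra hh; exact hj (h4 j (by omega))
    have hs := mon_split m j hj
    have hw := h2
    rw [hs, wtM_add, wtM_e] at hw
    have hq := h3
    rw [hs, qw_add, qw_e] at hq
    refine ⟨by simp [h1], ?_, ?_, fun i hi => ?_⟩
    · rw [wtM_add, wtM_e]; push_cast; linarith
    · rw [qw_add, qw_e]; nlinarith
    · have := h4 i (by omega)
      have h0 : j + 1 ≠ i := by omega
      simp [this, Finsupp.single_apply, h0]

theorem RR_supp (f : SF S) (k : ℕ) : RR f (k+2) ∈ SupM (LowP k) := by
  induction k with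
  | zero =>
    rw [RR_two]
    simp only [CF, uVar, AddMonoidAlgebra.single_mul_single]
    refine single_mem_SupM _ fun _ => ⟨by simp, ?_, ?_, by simp⟩
    · simp only [wtM_add, wtM_z]; norm_num
    · simp only [qw_add, qw_z]; norm_num
  | succ k ih =>
    rw [RR_succ]
    refine Submodule.add_mem _ ?_ (SupM_map _ (LowP_dx k) ih)
    rw [int_mul']
    refine Submodule.smul_mem _ _ (Submodule.add_mem _ ?_ ?_)
    · simp only [CF, uVar, AddMonoidAlgebra.single_mul_single]
      refine single_mem_SupM _ fun _ => ⟨by simp, ?_, ?_, fun j hj => ?_⟩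
      · simp only [wtM_add, wtM_z, wtM_e]; push_cast; ring
      · simp only [qw_add, qw_z, qw_e]
        have : (k+1+1)^2 = (k+1)^2 + (2*k+3) := by ring
        rw [this]; omega
      · have : k ≠ j := by omega
        simp [Finsupp.single_apply, this]
    · simp only [CF, uVar, AddMonoidAlgebra.single_mul_single]
      refine single_mem_SupM _ fun _ => ⟨by simp, ?_, ?_, fun j hj => ?_⟩
      · simp only [wtM_add, wtM_z, wtM_e]; push_cast; ring
      · simp only [qw_add, qw_z, qw_e]
        have : (k+1+1)^2 = (k+1)^2 + (2*k+3) := by ring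
        rw [this]; omega
      · have : k ≠ j := by omega
        have h0 : 0 ≠ j := by omega
        simp [Finsupp.single_apply, this, h0]

/-- filtration by the quadratic weight -/
def LowC (d : ℤ) (w : ℕ) (m : Mon) : Prop := m.2.2 = 0 ∧ wtM m = d ∧ qw m < w

theorem DV_RR_low (f : SF S) (d : ℤ) (w : ℕ) {y : Rl S} (hy : y ∈ SupM (LowC d (w+1))) :
    DV (RR f) y ∈ SupM (LowC (d+1) w) := by
  refine SupM_map _ ?_ hy
  rintro m c ⟨h1, h2, h3⟩
  obtain ⟨N, hN⟩ := DV_exists_sum (AddMonoidAlgebra.single m c)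
  rw [hN]
  refine Submodule.sum_mem _ fun i _ => ?_
  match i with
  | 0 => rw [RR_zero, zero_mul]; exact Submodule.zero_mem _
  | 1 => rw [RR_one, zero_mul]; exact Submodule.zero_mem _
  | (j+2) =>
    rw [PD_apply, pd2_single]
    refine SupM_mul (Q := fun n => m = n + (0, Finsupp.single j 1, 0)) ?_ (RR_supp f j)
      (single_mem_SupM _ fun hc => ?_)
    · rintro a n ⟨a1, a2, a3, -⟩ rfl
      rw [wtM_add, wtM_e] at h2
      rw [qw_add, qw_e] at h3
      refine ⟨?_, ?_, ?_⟩
      · simpa [a1] using h1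
      · rw [wtM_add]; linarith
      · rw [qw_add]; linarith
    · have hj : m.2.1 j ≠ 0 := by intro h0; rw [h0, zero_smul] at hc; exact hc rfl
      exact mon_split m j hj

/-- the diagonal part -/
def NN : Derivation ℝ (Rl S) (Rl S) := DV (fun i => (kap i : Rl S) * uVar S i)

theorem br_eq2 (f : SF S) (y : Rl S) :
    br y (fux S f) = CF S (dSF S hS f) * uVar S 1 * (y - NN y) - DV (RR f) y := by
  rw [br_eq]
  have : DV (RR f) y = DV (QQ f) y - CF S (dSF S hS f) * uVar S 1 * NN y := by
    rw [NN, ← DV_mul, ← DV_sub]; rfl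
  rw [this]; ring

theorem nu_eq (m : Mon) : nu m = wtM m + ((m.2.1.sum fun _ e => e : ℕ) : ℤ) := by
  simp only [nu, wtM, Finsupp.sum]
  push_cast
  rw [add_assoc, ← Finset.sum_add_distrib]
  congr 1
  exact Finset.sum_congr rfl fun _ _ => by ring

theorem NN_single (m : Mon) (c : SF S) (h : m.2.2 = 0) :
    NN (AddMonoidAlgebra.single m c) = (nu m : ℝ) • AddMonoidAlgebra.single m c := by
  obtain ⟨M, hM⟩ : ∃ M, ∀ j, M ≤ j → m.2.1 j = 0 := by
    refine ⟨m.2.1.support.sup id + 1, fun j hj => ?_⟩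
    by_contra h0
    have := Finset.le_sup (f := id) (Finsupp.mem_support_iff.mpr h0)
    simp only [id] at this
    omega
  rw [NN, DV_sum _ _ (M+2) ?_]
  · have key : ∀ j, (kap (j+2) : Rl S) * uVar S (j+2) * PD (j+2) (AddMonoidAlgebra.single m c)
        = (((j:ℤ)+3) * m.2.1 j : ℝ) • AddMonoidAlgebra.single m c := by
      intro j
      rw [mul_assoc, int_mul', PD_apply, pd2_single, uVar2_mul, ← Nat.cast_smul_eq_nsmul ℝ,
        ← AddMonoidAlgebra.smul_single, smul_smul]
      by_cases hj : m.2.1 j = 0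
      · simp [hj]
      · rw [add_comm (0, Finsupp.single j 1, 0), ← mon_split m j hj]; simp [kap]
    have k1 : (kap 1 : Rl S) * uVar S 1 * PD 1 (AddMonoidAlgebra.single m c)
        = (m.1 : ℝ) • AddMonoidAlgebra.single m c := by
      rw [PD_apply, pd1_single, h, zero_smul, AddMonoidAlgebra.single_zero, add_zero, mul_assoc,
        uVar1_mul, int_mul', ← Int.cast_smul_eq_zsmul ℝ, ← AddMonoidAlgebra.smul_single, smul_smul]
      have : ((1, 0, 0) + (m.1 - 1, m.2.1, 0) : Mon) = m := by
        ext <;> simp [h]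
      rw [this]; simp [kap]
    rw [Finset.sum_range_succ', Finset.sum_range_succ', zero_add, k1]
    rw [Finset.sum_congr rfl fun j _ => key j, ← Finset.sum_smul]
    simp only [kap, Int.cast_zero, zero_mul, add_zero]
    rw [← add_smul]
    congr 1
    rw [nu, Finsupp.sum_of_support_subset (s := Finset.range M)]
    · push_cast; ring
    · intro j hj
      by_contra h0
      exact Finsupp.mem_support_iff.mp hj (hM j (by simpa using h0))
    · simp
  · intro i hi
    obtain ⟨j, rfl⟩ : ∃ j, i = j + 2 := ⟨i - 2, by omega⟩
    rw [PD_apply, pd2_single, hM j (by omega), zero_smul, AddMonoidAlgebra.single_zero]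

theorem NN_coeff {y : Rl S} (hy : y ∈ SupM fun m => m.2.2 = 0) (m : Mon) :
    (NN y).coeff m = (nu m : ℝ) • y.coeff m := by
  refine SupM_induction (motive := fun y => (NN y).coeff m = (nu m : ℝ) • y.coeff m) hy ?_ ?_ ?_
  · rw [map_zero]; simp
  · intro p q hp hq
    rw [map_add, AddMonoidAlgebra.coeff_add, Finsupp.add_apply, hp, hq, AddMonoidAlgebra.coeff_add,
      Finsupp.add_apply, smul_add]
  · intro n c hn
    rw [NN_single n c hn, AddMonoidAlgebra.coeff_smul, Finsupp.smul_apply,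
      AddMonoidAlgebra.coeff_single, Finsupp.single_apply]
    split_ifs with h1
    · rw [h1]
    · simp

theorem diag_solve {P : Mon → Prop} (hP : ∀ m, P m → m.2.2 = 0 ∧ nu m ≠ 1) {h : Rl S}
    (hh : h ∈ SupM P) : ∃ y ∈ SupM P, y - NN y = h := by
  refine SupM_induction (motive := fun h => ∃ y ∈ SupM P, y - NN y = h) hh ?_ ?_ ?_
  · exact ⟨0, Submodule.zero_mem _, by rw [map_zero]; exact sub_self _⟩
  · rintro p q ⟨y, hy, rfl⟩ ⟨z, hz, rfl⟩
    exact ⟨y + z, Submodule.add_mem _ hy hz, by rw [map_add]; ring⟩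
  · intro m c hm
    have h1 : (1 - nu m : ℝ) ≠ 0 := by
      have := (hP m hm).2
      intro h0
      apply this
      have : (nu m : ℝ) = 1 := by linarith
      exact_mod_cast this
    refine ⟨(1 - nu m : ℝ)⁻¹ • AddMonoidAlgebra.single m c,
      Submodule.smul_mem _ _ (single_mem_SupM _ fun _ => hm), ?_⟩
    rw [Derivation.map_smul, NN_single m c (hP m hm).1, sub_eq_iff_eq_add, smul_smul]
    nth_rw 2 [← one_smul ℝ (AddMonoidAlgebra.single m c)]
    rw [← add_smul]
    congr 1
    field_simp
    ring

theorem SupM_low_zero {d : ℤ} {y : Rl S} (hy : y ∈ SupM (LowC d 0)) : y = 0 := by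
  refine AddMonoidAlgebra.ext (Finsupp.ext fun m => ?_)
  by_contra h
  exact absurd (hy m h).2.2 (Nat.not_lt_zero _)

theorem exists_low {P : Mon → Prop} {y : Rl S} (hy : y ∈ SupM P) :
    ∃ w, y ∈ SupM fun m => P m ∧ qw m < w := by
  refine ⟨y.coeff.support.sup qw + 1, fun m hm => ⟨hy m hm, ?_⟩⟩
  have := Finset.le_sup (f := qw) (Finsupp.mem_support_iff.mpr hm)
  omega

theorem exists_inv (f : SF S) (hf : ∀ x, (dSF S hS f : ℝ → ℝ) x ≠ 0) :
    ∃ J ∈ SupM (fun m => m = (-1, 0, 0)), CF S (dSF S hS f) * uVar S 1 * J = 1 := by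
  have hc : ContDiffOn ℝ ∞ (fun x => ((dSF S hS f : ℝ → ℝ) x)⁻¹) S :=
    ContDiffOn.inv (dSF S hS f).2 fun x _ => hf x
  refine ⟨AddMonoidAlgebra.single (-1, 0, 0) ⟨_, hc⟩, single_mem_SupM _ fun _ => rfl, ?_⟩
  rw [CF, uVar, AddMonoidAlgebra.single_mul_single, AddMonoidAlgebra.single_mul_single,
    AddMonoidAlgebra.one_def]
  congr 1
  refine Subtype.ext (funext fun x => ?_)
  simp only [mul_one]
  exact mul_inv_cancel₀ (hf x)

theorem br_add_left (x y z : Rl S) : br (x + y) z = br x z + br y z := by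
  simp only [br, map_add, LinearMap.add_apply]; ring

theorem br_sub_left (x y z : Rl S) : br (x - y) z = br x z - br y z := by
  rw [eq_sub_iff_add_eq, ← br_add_left, sub_add_cancel]

theorem solve_low (f : SF S) (hf : ∀ x, (dSF S hS f : ℝ → ℝ) x ≠ 0) (d : ℤ) (hd : 2 ≤ d) (w : ℕ) :
    ∀ g ∈ SupM (LowC (d+1) w), ∃ y ∈ SupM (LowC d w), br y (fux S f) = g := by
  obtain ⟨J, hJ, hJ1⟩ := exists_inv f hf
  induction w with
  | zero =>
    intro g hg
    refine ⟨0, Submodule.zero_mem _, ?_⟩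
    rw [SupM_low_zero hg, br, map_zero, map_zero]; simp
  | succ w ih =>
    intro g hg
    have hJg : J * g ∈ SupM (LowC d (w+1)) := by
      refine SupM_mul ?_ hJ hg
      rintro m n rfl ⟨h1, h2, h3⟩
      exact ⟨by simp [h1], by rw [wtM_add, wtM_z]; linarith, by rw [qw_add, qw_z]; linarith⟩
    obtain ⟨y, hy, hy1⟩ := diag_solve (fun m hm => ⟨hm.1, by
      rw [nu_eq, hm.2.1]; intro h
      have : (0:ℤ) ≤ ((m.2.1.sum fun _ e => e : ℕ) : ℤ) := Int.natCast_nonneg _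
      linarith⟩) hJg
    obtain ⟨z, hz, hz1⟩ := ih _ (DV_RR_low f d w hy)
    refine ⟨y + z, Submodule.add_mem _ hy (SupM_mono (fun m hm => ⟨hm.1, hm.2.1, by
      have := hm.2.2; omega⟩) hz), ?_⟩
    rw [br_add_left, hz1, br_eq2, hy1, sub_add_cancel, ← mul_assoc, hJ1, one_mul]

theorem solve (f : SF S) (hf : ∀ x, (dSF S hS f : ℝ → ℝ) x ≠ 0) (d : ℤ) (hd : 2 ≤ d)
    (g : Rl S) (hg : g ∈ Good (d+1)) : ∃ y ∈ Good d, br y (fux S f) = g := by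
  obtain ⟨w, hw⟩ := exists_low hg
  obtain ⟨y, hy, h⟩ := solve_low f hf d hd w g (SupM_mono (fun m hm => ⟨hm.1.1, hm.1.2, hm.2⟩) hw)
  exact ⟨y, SupM_mono (fun m hm => ⟨hm.1, hm.2.1⟩) hy, h⟩

theorem ker_low (f : SF S) (hf : ∀ x, (dSF S hS f : ℝ → ℝ) x ≠ 0) (d : ℤ) (w : ℕ) (y : Rl S)
    (hn : y ∈ SupM fun m => nu m ≠ 1) (hb : br y (fux S f) = 0) :
    y ∈ SupM (LowC d w) → y = 0 := by
  obtain ⟨J, hJ, hJ1⟩ := exists_inv f hf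
  induction w with
  | zero => exact SupM_low_zero
  | succ w ih =>
    intro hy
    apply ih
    rw [br_eq2] at hb
    have h1 : y - NN y = J * DV (RR f) y := by
      rw [← sub_eq_zero.mp hb, ← mul_assoc, mul_comm J, hJ1, one_mul]
    have h2 : J * DV (RR f) y ∈ SupM (LowC d w) := by
      refine SupM_mul ?_ hJ (DV_RR_low f d w hy)
      rintro m n rfl ⟨h1, h2, h3⟩
      exact ⟨by simp [h1], by rw [wtM_add, wtM_z]; linarith, by rw [qw_add, qw_z]; linarith⟩
    rw [← h1] at h2
    intro m hm
    apply h2 m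
    intro h0
    have h3 := congrArg (fun r : Rl S => r.coeff m) (sub_add_cancel y (NN y))
    simp only [AddMonoidAlgebra.coeff_add, Finsupp.add_apply, h0, zero_add] at h3
    rw [NN_coeff (SupM_mono (fun m hm => hm.1) hy)] at h3
    have h4 : (nu m - 1 : ℝ) • y.coeff m = 0 := by
      rw [sub_smul, h3, one_smul, sub_self]
    rcases smul_eq_zero.mp h4 with h5 | h5
    · apply hn m hm
      have : (nu m : ℝ) = 1 := by linarith
      exact_mod_cast this
    · exact hm h5

theorem ker2 (f : SF S) (hf : ∀ x, (dSF S hS f : ℝ → ℝ) x ≠ 0) (d : ℤ) (hd : 2 ≤ d) (y : Rl S)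
    (hy : y ∈ Good d) (hb : br y (fux S f) = 0) : y = 0 := by
  obtain ⟨w, hw⟩ := exists_low hy
  refine ker_low f hf d w y ?_ hb (SupM_mono (fun m hm => ⟨hm.1.1, hm.1.2, hm.2⟩) hw)
  refine SupM_mono (fun m hm => ?_) hy
  rw [nu_eq, hm.2]
  have : (0:ℤ) ≤ ((m.2.1.sum fun _ e => e : ℕ) : ℤ) := Int.natCast_nonneg _
  intro h
  linarith

theorem fux_single (c : SF S) : fux S c = AddMonoidAlgebra.single (1, 0, 0) c := by
  rw [fux, CF, uVar, AddMonoidAlgebra.single_mul_single, mul_one]; rfl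

theorem ker1 (f : SF S) (hf : ∀ x, (dSF S hS f : ℝ → ℝ) x ≠ 0) (y : Rl S)
    (hy : y ∈ Good 1) (hb : br y (fux S f) = 0) : ∃ p, y = fux S p := by
  refine ⟨y.coeff (1, 0, 0), ?_⟩
  have hF : fux S (y.coeff (1, 0, 0)) ∈ Good 1 := by
    rw [fux_single]; exact single_mem_SupM _ fun _ => ⟨rfl, wtM_z 1⟩
  have hg := SupM_sub hy hF
  obtain ⟨w, hw⟩ := exists_low hg
  have hz : (y - fux S (y.coeff (1, 0, 0))).coeff (1, 0, 0) = 0 := by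
    have h3 := congrArg (fun r : Rl S => r.coeff (1, 0, 0))
      (sub_add_cancel y (fux S (y.coeff (1, 0, 0))))
    simp only [AddMonoidAlgebra.coeff_add, Finsupp.add_apply] at h3
    nth_rw 2 [fux_single] at h3
    rw [AddMonoidAlgebra.coeff_single, Finsupp.single_eq_same] at h3
    simpa using h3
  rw [← sub_eq_zero]
  refine ker_low f hf 1 w _ ?_ (by rw [br_sub_left, hb, br_fux, sub_self])
    (SupM_mono (fun m hm => ⟨hm.1.1, hm.1.2, hm.2⟩) hw)
  intro m hm h1
  obtain ⟨h2, h3⟩ := hg m hm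
  rw [nu_eq, h3] at h1
  have h4 : (m.2.1.sum fun _ e => e) = 0 := by
    have : ((m.2.1.sum fun _ e => e : ℕ) : ℤ) = 0 := by linarith
    exact_mod_cast this
  have h5 : m.2.1 = 0 := by
    refine Finsupp.ext fun k => ?_
    by_contra h0
    exact h0 (Finset.sum_eq_zero_iff.mp h4 k (Finsupp.mem_support_iff.mpr h0))
  have h6 : m.1 = 1 := by
    rw [wtM, h5] at h3; simpa using h3
  apply hm
  have : m = (1, 0, 0) := Prod.ext h6 (Prod.ext h5 h2)
  rw [this]; exact hz

section expo
variable {A : Type*} [Ring A] [Algebra ℝ A]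

/-- order of vanishing at least `k` -/
def VOrd (k : ℕ) (a : PowerSeries A) : Prop := ∀ n, n < k → PowerSeries.coeff n a = 0

theorem Ord_mul {k l : ℕ} {a b : PowerSeries A} (ha : VOrd k a) (hb : VOrd l b) :
    VOrd (k + l) (a * b) := by
  intro n hn
  rw [PowerSeries.coeff_mul]
  refine Finset.sum_eq_zero fun p hp => ?_
  have := Finset.HasAntidiagonal.mem_antidiagonal.mp hp
  by_cases h : p.1 < k
  · rw [ha _ h, zero_mul]
  · rw [hb _ (by omega), mul_zero]

theorem Ord_sub {k : ℕ} {a b : PowerSeries A} (ha : VOrd k a) (hb : VOrd k b) :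
    VOrd k (a - b) := by
  intro n hn
  rw [map_sub, ha n hn, hb n hn, sub_zero]

theorem Ord_smul {k : ℕ} {a : PowerSeries A} (ha : VOrd k a) (r : ℝ) : VOrd k (r • a) := by
  intro n hn
  rw [PowerSeries.coeff_smul, ha n hn, smul_zero]

theorem Ord_one {a : PowerSeries A} (ha : PowerSeries.coeff 0 a = 0) : VOrd 1 a := by
  intro n hn
  obtain rfl : n = 0 := by omega
  exact ha

/-- summation of a family of increasing order -/
def SS (c : ℕ → PowerSeries A) : PowerSeries A :=
  PowerSeries.mk fun n => ∑ m ∈ Finset.range (n+1), PowerSeries.coeff n (c m)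

theorem coeff_SS (c : ℕ → PowerSeries A) (n : ℕ) : PowerSeries.coeff n (SS c)
    = ∑ m ∈ Finset.range (n+1), PowerSeries.coeff n (c m) := PowerSeries.coeff_mk _ _

theorem coeff_SS_le (c : ℕ → PowerSeries A) (hc : ∀ m, VOrd m (c m)) (n N : ℕ) (h : n ≤ N) :
    PowerSeries.coeff n (SS c) = ∑ m ∈ Finset.range (N+1), PowerSeries.coeff n (c m) := by
  rw [coeff_SS]
  refine Finset.sum_subset (fun x hx => ?_) (fun x _ hx => ?_)
  · rw [Finset.mem_range] at *; omega
  · rw [Finset.mem_range] at hx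
    exact hc x n (by omega)

theorem sum_triangle {B : Type*} [AddCommMonoid B] (f : ℕ × ℕ → B) (n : ℕ)
    (h : ∀ p : ℕ × ℕ, n < p.1 + p.2 → f p = 0) :
    ∑ k ∈ Finset.range (n+1), ∑ l ∈ Finset.range (n+1), f (k, l)
      = ∑ m ∈ Finset.range (n+1), ∑ p ∈ Finset.HasAntidiagonal.antidiagonal m, f p := by
  rw [← Finset.sum_product']
  have h1 : ∑ p ∈ Finset.range (n+1) ×ˢ Finset.range (n+1), f (p.1, p.2)
      = ∑ p ∈ (Finset.range (n+1) ×ˢ Finset.range (n+1)).filter (fun p => p.1 + p.2 ≤ n), f p := by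
    symm
    refine Finset.sum_subset (Finset.filter_subset _ _) (fun x hx hx' => h x ?_)
    by_contra h0
    exact hx' (Finset.mem_filter.mpr ⟨hx, by omega⟩)
  rw [h1, ← Finset.sum_fiberwise_of_maps_to (g := fun p : ℕ × ℕ => p.1 + p.2)
    (t := Finset.range (n+1))]
  · refine Finset.sum_congr rfl fun m hm => Finset.sum_congr ?_ fun _ _ => rfl
    ext p
    simp only [Finset.mem_filter, Finset.mem_product, Finset.mem_range,
      Finset.HasAntidiagonal.mem_antidiagonal] at *
    omega
  · intro p hp
    rw [Finset.mem_range]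
    have := (Finset.mem_filter.mp hp).2
    omega

theorem SS_mul (c d : ℕ → PowerSeries A) (hc : ∀ m, VOrd m (c m)) (hd : ∀ m, VOrd m (d m)) :
    SS c * SS d = SS fun m => ∑ p ∈ Finset.HasAntidiagonal.antidiagonal m, c p.1 * d p.2 := by
  refine PowerSeries.ext fun n => ?_
  rw [coeff_SS, PowerSeries.coeff_mul]
  have h1 : ∀ p ∈ Finset.HasAntidiagonal.antidiagonal n, PowerSeries.coeff p.1 (SS c) * PowerSeries.coeff p.2 (SS d)
      = ∑ k ∈ Finset.range (n+1), ∑ l ∈ Finset.range (n+1),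
        PowerSeries.coeff p.1 (c k) * PowerSeries.coeff p.2 (d l) := by
    intro p hp
    have := Finset.HasAntidiagonal.mem_antidiagonal.mp hp
    rw [coeff_SS_le c hc _ n (by omega), coeff_SS_le d hd _ n (by omega), Finset.sum_mul_sum]
  rw [Finset.sum_congr rfl h1, Finset.sum_comm]
  have h2 : ∀ k ∈ Finset.range (n+1), ∑ p ∈ Finset.HasAntidiagonal.antidiagonal n, ∑ l ∈ Finset.range (n+1),
        PowerSeries.coeff p.1 (c k) * PowerSeries.coeff p.2 (d l)
        = ∑ l ∈ Finset.range (n+1), PowerSeries.coeff n (c k * d l) := by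
    intro k _
    rw [Finset.sum_comm]
    exact Finset.sum_congr rfl fun l _ => (PowerSeries.coeff_mul _ _ _).symm
  rw [Finset.sum_congr rfl h2, sum_triangle (fun p => PowerSeries.coeff n (c p.1 * d p.2)) n
    (fun p hp => Ord_mul (hc _) (hd _) _ hp)]
  exact Finset.sum_congr rfl fun m _ => (map_sum _ _ _).symm

theorem SS_const (b : PowerSeries A) : SS (fun m => if m = 0 then b else 0) = b := by
  refine PowerSeries.ext fun n => ?_
  rw [coeff_SS, Finset.sum_eq_single 0]
  · rw [if_pos rfl]
  · intro m _ hm; rw [if_neg hm, map_zero]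
  · intro h; exact absurd (Finset.mem_range.mpr (Nat.succ_pos n)) h

theorem SS_mul_right (c : ℕ → PowerSeries A) (hc : ∀ m, VOrd m (c m)) (b : PowerSeries A) :
    SS c * b = SS fun m => c m * b := by
  have hd : ∀ m, VOrd m ((fun m => if m = 0 then b else 0 : ℕ → PowerSeries A) m) := by
    intro m n hn
    have : m ≠ 0 := by omega
    simp [this]
  conv_lhs => rw [← SS_const b]
  rw [SS_mul c _ hc hd]
  congr 1
  funext m
  rw [Finset.sum_eq_single (m, 0)]
  · rfl
  · intro p hp hne
    have := Finset.HasAntidiagonal.mem_antidiagonal.mp hp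
    have h0 : p.2 ≠ 0 := by
      intro h0; apply hne; ext <;> simp <;> omega
    simp [h0]
  · intro h; exact absurd (Finset.HasAntidiagonal.mem_antidiagonal.mpr (by simp)) h

theorem antidiag_step {B : Type*} [AddCommGroup B] [Module ℝ B] (f : ℕ × ℕ → B) (m : ℕ) :
    ((m:ℝ)+1) • ∑ p ∈ Finset.HasAntidiagonal.antidiagonal (m+1), f p
      = ∑ p ∈ Finset.HasAntidiagonal.antidiagonal m,
        (((p.1:ℝ)+1) • f (p.1+1, p.2) + ((p.2:ℝ)+1) • f (p.1, p.2+1)) := by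
  have h1 : ((m:ℝ)+1) • ∑ p ∈ Finset.HasAntidiagonal.antidiagonal (m+1), f p
      = ∑ p ∈ Finset.HasAntidiagonal.antidiagonal (m+1), ((p.1:ℝ) • f p) +
        ∑ p ∈ Finset.HasAntidiagonal.antidiagonal (m+1), ((p.2:ℝ) • f p) := by
    rw [Finset.smul_sum, ← Finset.sum_add_distrib]
    refine Finset.sum_congr rfl fun p hp => ?_
    have := Finset.HasAntidiagonal.mem_antidiagonal.mp hp
    rw [← add_smul]
    congr 1
    exact_mod_cast this.symm
  rw [h1, Finset.Nat.sum_antidiagonal_succ, Finset.Nat.sum_antidiagonal_succ',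
    Finset.sum_add_distrib]
  simp

/-- divided powers -/
def dpow (a : PowerSeries A) (m : ℕ) : PowerSeries A := ((m.factorial : ℝ)⁻¹) • a ^ m

/-- the commutator with `a` -/
def adS (a b : PowerSeries A) : PowerSeries A := a * b - b * a

/-- divided powers of the commutator -/
def dad (a b : PowerSeries A) (m : ℕ) : PowerSeries A :=
  ((m.factorial : ℝ)⁻¹) • (adS a)^[m] b

theorem fact_step (m : ℕ) : ((m:ℝ)+1) * (((m+1).factorial : ℝ)⁻¹) = ((m.factorial : ℝ)⁻¹) := by
  rw [Nat.factorial_succ]; push_cast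
  have : (m.factorial : ℝ) ≠ 0 := by exact_mod_cast m.factorial_ne_zero
  have : (m : ℝ) + 1 ≠ 0 := by positivity
  field_simp

theorem dpow_step (a : PowerSeries A) (m : ℕ) : ((m:ℝ)+1) • dpow a (m+1) = a * dpow a m := by
  rw [dpow, smul_smul, fact_step, dpow, mul_smul_comm, pow_succ']

theorem adS_smul (a b : PowerSeries A) (r : ℝ) : adS a (r • b) = r • adS a b := by
  rw [adS, adS, mul_smul_comm, smul_mul_assoc, smul_sub]

theorem dad_step (a b : PowerSeries A) (m : ℕ) :
    ((m:ℝ)+1) • dad a b (m+1) = adS a (dad a b m) := by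
  rw [dad, smul_smul, fact_step, dad, adS_smul, Function.iterate_succ_apply']

theorem dpow_comm (a : PowerSeries A) (m : ℕ) : dpow a m * a = a * dpow a m := by
  rw [dpow, mul_smul_comm, smul_mul_assoc, ← pow_succ, ← pow_succ']

theorem dad_dpow (a b : PowerSeries A) (m : ℕ) :
    ∑ p ∈ Finset.HasAntidiagonal.antidiagonal m, dad a b p.1 * dpow a p.2 = dpow a m * b := by
  induction m with
  | zero => simp [dad, dpow]
  | succ m ih =>
    have h0 : ((m:ℝ)+1) ≠ 0 := by positivity
    have h1 : ((m:ℝ)+1) • ∑ p ∈ Finset.HasAntidiagonal.antidiagonal (m+1), dad a b p.1 * dpow a p.2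
        = ((m:ℝ)+1) • (dpow a (m+1) * b) := by
      rw [antidiag_step, ← smul_mul_assoc, dpow_step, mul_assoc, ← ih, Finset.mul_sum]
      refine Finset.sum_congr rfl fun p _ => ?_
      rw [← smul_mul_assoc, ← mul_smul_comm, dad_step, dpow_step, adS, sub_mul, mul_assoc, mul_assoc,
        sub_add_cancel]
    have h2 := congrArg (fun x => ((m:ℝ)+1)⁻¹ • x) h1
    simpa only [smul_smul, inv_mul_cancel₀ h0, one_smul] using h2

theorem Ord_pow {a : PowerSeries A} (ha : PowerSeries.coeff 0 a = 0) (m : ℕ) : VOrd m (a ^ m) := by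
  induction m with
  | zero => intro n hn; omega
  | succ m ih => rw [pow_succ]; exact Ord_mul ih (Ord_one ha)

theorem Ord_dpow {a : PowerSeries A} (ha : PowerSeries.coeff 0 a = 0) (m : ℕ) :
    VOrd m (dpow a m) := Ord_smul (Ord_pow ha m) _

theorem Ord_dad {a : PowerSeries A} (ha : PowerSeries.coeff 0 a = 0) (b : PowerSeries A) (m : ℕ) :
    VOrd m (dad a b m) := by
  refine Ord_smul ?_ _
  induction m with
  | zero => intro n hn; omega
  | succ m ih =>
    rw [Function.iterate_succ_apply']
    refine Ord_sub ?_ (Ord_mul ih (Ord_one ha))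
    have := Ord_mul (Ord_one ha) ih
    rwa [add_comm] at this

/-- the exponential -/
def expS (a : PowerSeries A) : PowerSeries A := SS (dpow a)

theorem adexp {a : PowerSeries A} (ha : PowerSeries.coeff 0 a = 0) (b : PowerSeries A) :
    SS (dad a b) * expS a = expS a * b := by
  rw [expS, SS_mul _ _ (Ord_dad ha b) (Ord_dpow ha), SS_mul_right _ (Ord_dpow ha)]
  congr 1
  funext m
  exact dad_dpow a b m

theorem coeff_zero_expS (a : PowerSeries A) : PowerSeries.coeff 0 (expS a) = 1 := by
  rw [expS, coeff_SS]; simp [dpow]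

theorem coeff_one_expS (a : PowerSeries A) :
    PowerSeries.coeff 1 (expS a) = PowerSeries.coeff 1 a := by
  rw [expS, coeff_SS]; simp [dpow, Finset.sum_range_succ, PowerSeries.coeff_one]

theorem cancel_right {a b φ : PowerSeries A} (hφ : PowerSeries.coeff 0 φ = 1)
    (h : a * φ = b * φ) : a = b := by
  refine PowerSeries.ext fun n => ?_
  induction n using Nat.strong_induction_on with
  | _ n ih =>
    have h1 := congrArg (PowerSeries.coeff n) h
    rw [PowerSeries.coeff_mul, PowerSeries.coeff_mul] at h1
    have hmem : (n, 0) ∈ Finset.HasAntidiagonal.antidiagonal n := Finset.HasAntidiagonal.mem_antidiagonal.mpr (by simp)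
    rw [← Finset.add_sum_erase _ _ hmem, ← Finset.add_sum_erase _ _ hmem] at h1
    have h2 : ∀ p ∈ (Finset.HasAntidiagonal.antidiagonal n).erase (n, 0),
        PowerSeries.coeff p.1 a * PowerSeries.coeff p.2 φ
          = PowerSeries.coeff p.1 b * PowerSeries.coeff p.2 φ := by
      intro p hp
      rw [Finset.mem_erase] at hp
      have := Finset.HasAntidiagonal.mem_antidiagonal.mp hp.2
      rw [ih p.1 ?_]
      by_contra h0
      apply hp.1; ext <;> simp <;> omega
    rw [Finset.sum_congr rfl h2] at h1
    have h3 := add_right_cancel h1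
    simpa only [hφ, mul_one] using h3

/-- series whose coefficients satisfy a graded property -/
def GrS (P : ℕ → Submodule ℝ A) (a : PowerSeries A) : Prop := ∀ n, PowerSeries.coeff n a ∈ P n

theorem GrS_mul {P : ℕ → Submodule ℝ A} (hP : ∀ i j x y, x ∈ P i → y ∈ P j → x * y ∈ P (i + j))
    {a b : PowerSeries A} (ha : GrS P a) (hb : GrS P b) : GrS P (a * b) := by
  intro n
  rw [PowerSeries.coeff_mul]
  refine Submodule.sum_mem _ fun p hp => ?_
  have := hP _ _ _ _ (ha p.1) (hb p.2)
  rwa [Finset.HasAntidiagonal.mem_antidiagonal.mp hp] at this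

theorem GrS_expS {P : ℕ → Submodule ℝ A} (h1 : 1 ∈ P 0)
    (hP : ∀ i j x y, x ∈ P i → y ∈ P j → x * y ∈ P (i + j))
    {a : PowerSeries A} (ha : GrS P a) : GrS P (expS a) := by
  have hp : ∀ m, GrS P (a ^ m) := by
    intro m
    induction m with
    | zero =>
      intro n
      rw [pow_zero, PowerSeries.coeff_one]
      split_ifs with h
      · rw [h]; exact h1
      · exact Submodule.zero_mem _
    | succ m ih => rw [pow_succ]; exact GrS_mul hP ih ha
  intro n
  rw [expS, coeff_SS]
  refine Submodule.sum_mem _ fun m _ => ?_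
  rw [dpow, PowerSeries.coeff_smul]
  exact Submodule.smul_mem _ _ (hp m n)

end expo

/-- operators on the jet ring -/
abbrev EE : Type := Module.End ℝ (Rl S)

/-- the operator series of a vector field series -/
def hat (Y : Ser S) : PowerSeries EE := PowerSeries.mk fun n => XHL (Y n)

theorem coeff_hat (Y : Ser S) (n : ℕ) : PowerSeries.coeff n (hat Y) = XHL (Y n) :=
  PowerSeries.coeff_mk _ _

theorem hat_inj {X Y : Ser S} (h : hat X = hat Y) : X = Y := by
  funext n
  apply XHL_inj
  rw [← coeff_hat, h, coeff_hat]

theorem sum_swap {B : Type*} [AddCommMonoid B] (f : ℕ × ℕ → B) (n : ℕ) :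
    ∑ p ∈ Finset.HasAntidiagonal.antidiagonal n, f p
      = ∑ p ∈ Finset.HasAntidiagonal.antidiagonal n, f (p.2, p.1) :=
  (Finset.Nat.sum_antidiagonal_swap (f := f)).symm

theorem brk_eq (X Y : Ser S) (n : ℕ) : brk S hS X Y n
    = ∑ p ∈ Finset.HasAntidiagonal.antidiagonal n, br (X p.1) (Y p.2) := by
  have h1 : ∀ X Y : Ser S, XhatSer S hS X Y n
      = ∑ p ∈ Finset.HasAntidiagonal.antidiagonal n, XHL (X p.1) (Y p.2) := by
    intro X Y
    rw [Finset.Nat.sum_antidiagonal_eq_sum_range_succ (fun i j => XHL (X i) (Y j))]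
    rfl
  rw [brk, h1, h1, sub_eq_iff_eq_add, sum_swap (fun p => XHL (Y p.1) (X p.2)),
    ← Finset.sum_add_distrib]
  exact Finset.sum_congr rfl fun p _ => by rw [br, sub_add_cancel]

theorem hat_brk (X Y : Ser S) : hat (brk S hS X Y) = adS (hat X) (hat Y) := by
  refine PowerSeries.ext fun n => ?_
  rw [coeff_hat, brk_eq, map_sum, adS, map_sub, PowerSeries.coeff_mul, PowerSeries.coeff_mul,
    eq_sub_iff_add_eq, sum_swap (fun p => PowerSeries.coeff p.1 (hat Y) * PowerSeries.coeff p.2 (hat X)),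
    ← Finset.sum_add_distrib]
  refine Finset.sum_congr rfl fun p _ => ?_
  simp only [coeff_hat]
  rw [XHL_br, sub_add_cancel]

theorem hat_gV (Y W : Ser S) : hat (gV S hS Y W) = SS (dad (hat Y) (hat W)) := by
  have h : ∀ m, hat ((brk S hS Y)^[m] W) = (adS (hat Y))^[m] (hat W) := by
    intro m
    induction m with
    | zero => rfl
    | succ m ih => rw [Function.iterate_succ_apply', Function.iterate_succ_apply', hat_brk, ih]
  refine PowerSeries.ext fun n => ?_
  rw [coeff_hat, coeff_SS, gV, map_sum]
  refine Finset.sum_congr rfl fun m _ => ?_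
  rw [dad, PowerSeries.coeff_smul, ← h, coeff_hat, map_smul]

theorem gV_intertwine (Y W : Ser S) (h0 : Y 0 = 0) :
    hat (gV S hS Y W) * expS (hat Y) = expS (hat Y) * hat W := by
  rw [hat_gV]
  exact adexp (by rw [coeff_hat, h0, map_zero]) _

/-- multiplication operators -/
def MM (F : PowerSeries (Rl S)) : PowerSeries EE :=
  PowerSeries.mk fun n => Algebra.lmul ℝ (Rl S) (PowerSeries.coeff n F)

theorem coeff_MM (F : PowerSeries (Rl S)) (n : ℕ) : PowerSeries.coeff n (MM F)
    = Algebra.lmul ℝ (Rl S) (PowerSeries.coeff n F) := PowerSeries.coeff_mk _ _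

/-- evaluation at `1` -/
def evv (a : PowerSeries EE) : PowerSeries (Rl S) :=
  PowerSeries.mk fun n => (PowerSeries.coeff n a) 1

theorem coeff_evv (a : PowerSeries EE) (n : ℕ) : PowerSeries.coeff n (evv a)
    = (PowerSeries.coeff n a) 1 := PowerSeries.coeff_mk _ _

/-- application of an operator series -/
def act (a : PowerSeries EE) (F : PowerSeries (Rl S)) : PowerSeries (Rl S) :=
  PowerSeries.mk fun n => ∑ p ∈ Finset.HasAntidiagonal.antidiagonal n,
    (PowerSeries.coeff p.1 a) (PowerSeries.coeff p.2 F)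

theorem evv_mul (a b : PowerSeries EE) : evv (a * b) = act a (evv b) := by
  refine PowerSeries.ext fun n => ?_
  rw [coeff_evv, act, PowerSeries.coeff_mk, PowerSeries.coeff_mul, LinearMap.sum_apply]
  exact Finset.sum_congr rfl fun p _ => by rw [coeff_evv]; rfl

theorem evv_one : evv 1 = 1 := by
  refine PowerSeries.ext fun n => ?_
  rw [coeff_evv, PowerSeries.coeff_one, PowerSeries.coeff_one]
  split_ifs <;> rfl

theorem act_one (a : PowerSeries EE) : act a 1 = evv a := by
  rw [← evv_one, ← evv_mul, mul_one]

theorem evv_MM_mul (F : PowerSeries (Rl S)) (a : PowerSeries EE) : evv (MM F * a) = F * evv a := by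
  refine PowerSeries.ext fun n => ?_
  rw [coeff_evv, PowerSeries.coeff_mul, PowerSeries.coeff_mul, LinearMap.sum_apply]
  exact Finset.sum_congr rfl fun p _ => by rw [coeff_evv, coeff_MM]; rfl

theorem evv_MM (F : PowerSeries (Rl S)) : evv (MM F) = F := by
  have := evv_MM_mul F 1
  rwa [evv_one, mul_one, mul_one] at this

theorem adS_MM (Y : Ser S) (F : PowerSeries (Rl S)) :
    adS (hat Y) (MM F) = MM (act (hat Y) F) := by
  refine PowerSeries.ext fun n => ?_
  rw [adS, map_sub, PowerSeries.coeff_mul, PowerSeries.coeff_mul, sub_eq_iff_eq_add,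
    sum_swap (fun p => PowerSeries.coeff p.1 (MM F) * PowerSeries.coeff p.2 (hat Y)),
    coeff_MM, act, PowerSeries.coeff_mk, map_sum, ← Finset.sum_add_distrib]
  refine Finset.sum_congr rfl fun p _ => ?_
  refine LinearMap.ext fun g => ?_
  rw [coeff_MM, coeff_hat]
  change XH (Y p.1) (PowerSeries.coeff p.2 F * g) = XH (Y p.1) (PowerSeries.coeff p.2 F) * g
    + PowerSeries.coeff p.2 F * XH (Y p.1) g
  rw [Derivation.leibniz, smul_eq_mul, smul_eq_mul]; ring

/-- multiplicative operator series -/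
def Mlt (a : PowerSeries EE) : Prop := evv a = 1 ∧ ∀ F, ∃ H, a * MM F = MM H * a

theorem Mlt_mul {a b : PowerSeries EE} (ha : Mlt a) (hb : Mlt b) : Mlt (a * b) := by
  refine ⟨by rw [evv_mul, hb.1, act_one, ha.1], fun F => ?_⟩
  obtain ⟨G, hG⟩ := hb.2 F
  obtain ⟨H, hH⟩ := ha.2 G
  exact ⟨H, by rw [mul_assoc, hG, ← mul_assoc, hH, mul_assoc]⟩

theorem Mlt_act {a : PowerSeries EE} (ha : Mlt a) (F G : PowerSeries (Rl S)) :
    act a (F * G) = act a F * act a G := by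
  obtain ⟨H, hH⟩ := ha.2 F
  have h1 : act a F = H := by
    rw [← evv_MM F, ← evv_mul, hH, evv_MM_mul, ha.1, mul_one]
  have h2 : F * G = evv (MM F * MM G) := by rw [evv_MM_mul, evv_MM]
  rw [h1, h2, ← evv_mul, ← mul_assoc, hH, mul_assoc, evv_MM_mul, evv_mul, evv_MM]

theorem act_C (a : PowerSeries EE) (f : Rl S) (n : ℕ) :
    PowerSeries.coeff n (act a (PowerSeries.C f)) = (PowerSeries.coeff n a) f := by
  rw [act, PowerSeries.coeff_mk, Finset.sum_eq_single (n, 0)]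
  · rw [PowerSeries.coeff_C, if_pos rfl]
  · intro p hp hne
    have := Finset.HasAntidiagonal.mem_antidiagonal.mp hp
    have h0 : p.2 ≠ 0 := by
      intro h0; apply hne; ext <;> simp <;> omega
    rw [PowerSeries.coeff_C, if_neg h0, map_zero]
  · intro h; exact absurd (Finset.HasAntidiagonal.mem_antidiagonal.mpr (by simp)) h

theorem Mlt_coeff {a : PowerSeries EE} (ha : Mlt a) (f g : Rl S) (n : ℕ) :
    (PowerSeries.coeff n a) (f * g) = ∑ p ∈ Finset.HasAntidiagonal.antidiagonal n,
      (PowerSeries.coeff p.1 a) f * (PowerSeries.coeff p.2 a) g := by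
  rw [← act_C, map_mul, Mlt_act ha, PowerSeries.coeff_mul]
  exact Finset.sum_congr rfl fun p _ => by rw [act_C, act_C]

theorem Mlt_expS (Y : Ser S) (h0 : Y 0 = 0) : Mlt (expS (hat Y)) := by
  have hY : PowerSeries.coeff 0 (hat Y) = 0 := by rw [coeff_hat, h0, map_zero]
  constructor
  · refine PowerSeries.ext fun n => ?_
    rw [coeff_evv, expS, coeff_SS, LinearMap.sum_apply, Finset.sum_range_succ']
    rw [Finset.sum_eq_zero, zero_add]
    · rw [dpow, pow_zero, PowerSeries.coeff_smul, PowerSeries.coeff_one, PowerSeries.coeff_one]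
      split_ifs <;> simp
    · intro m _
      rw [dpow, PowerSeries.coeff_smul, pow_succ, LinearMap.smul_apply, PowerSeries.coeff_mul,
        LinearMap.sum_apply, Finset.sum_eq_zero, smul_zero]
      intro p _
      rw [coeff_hat]
      change (PowerSeries.coeff p.1 (hat Y ^ m)) (XH (Y p.2) 1) = 0
      rw [Derivation.map_one_eq_zero, map_zero]
  · intro F
    have h : ∀ m, (adS (hat Y))^[m] (MM F) = MM ((act (hat Y))^[m] F) := by
      intro m
      induction m with
      | zero => rfl
      | succ m ih => rw [Function.iterate_succ_apply', Function.iterate_succ_apply', ih, adS_MM]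
    refine ⟨PowerSeries.mk fun n => ∑ m ∈ Finset.range (n+1), ((m.factorial : ℝ)⁻¹) •
      PowerSeries.coeff n ((act (hat Y))^[m] F), ?_⟩
    rw [← adexp hY]
    congr 1
    refine PowerSeries.ext fun n => ?_
    rw [coeff_MM, coeff_SS, PowerSeries.coeff_mk, map_sum]
    refine Finset.sum_congr rfl fun m _ => ?_
    rw [dad, h, PowerSeries.coeff_smul, coeff_MM, map_smul]

/-- operators commuting with the total derivative -/
def ComS : Submodule ℝ EE where
  carrier := {T | ∀ p, T (dxD p) = dxD (T p)}
  zero_mem' := fun p => by simp only [LinearMap.zero_apply, map_zero]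
  add_mem' := fun {a b} ha hb p => by
    simp only [LinearMap.add_apply, map_add, ha p, hb p]
  smul_mem' := fun r a ha p => by
    rw [LinearMap.smul_apply, LinearMap.smul_apply, Derivation.map_smul, ha p]

/-- operators raising the degree by `n` -/
def HomS (n : ℕ) : Submodule ℝ EE where
  carrier := {T | ∀ (d : ℤ) p, p ∈ Good d → T p ∈ Good (d + n)}
  zero_mem' := fun d p _ => by
    rw [LinearMap.zero_apply]; exact Submodule.zero_mem _
  add_mem' := fun {a b} ha hb d p hp => by
    rw [LinearMap.add_apply]; exact Submodule.add_mem _ (ha d p hp) (hb d p hp)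
  smul_mem' := fun r a ha d p hp => by
    rw [LinearMap.smul_apply]; exact Submodule.smul_mem _ _ (ha d p hp)

/-- a finite expression in the derivatives of `H` -/
def lc (i : ℕ) (Q : ℕ →₀ Rl S) (H : Rl S) : Rl S := Q.sum fun j c => (PD i)^[j] H * c

theorem lc_zero (i : ℕ) (H : Rl S) : lc i 0 H = 0 := Finsupp.sum_zero_index

theorem lc_add (i : ℕ) (Q Q' : ℕ →₀ Rl S) (H : Rl S) : lc i (Q + Q') H = lc i Q H + lc i Q' H :=
  Finsupp.sum_add_index' (fun _ => mul_zero _) (fun _ _ _ => mul_add _ _ _)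

theorem lc_single (i j : ℕ) (c : Rl S) (H : Rl S) :
    lc i (Finsupp.single j c) H = (PD i)^[j] H * c :=
  Finsupp.sum_single_index (mul_zero _)

theorem lc_smul (i : ℕ) (r : ℝ) (Q : ℕ →₀ Rl S) (H : Rl S) : lc i (r • Q) H = r • lc i Q H := by
  induction Q using Finsupp.induction_linear with
  | zero => rw [smul_zero, lc_zero, smul_zero]
  | add Q Q' h h' => rw [smul_add, lc_add, lc_add, h, h', smul_add]
  | single j c => rw [Finsupp.smul_single, lc_single, lc_single, mul_smul_comm]

/-- differential-operator-like operators -/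
def LocS : Submodule ℝ EE where
  carrier := {T | ∀ i P, ∃ Q, ∀ H, Only i H → T (H * P) = lc i Q H}
  zero_mem' := fun i P => ⟨0, fun H _ => by rw [lc_zero, LinearMap.zero_apply]⟩
  add_mem' := fun {a b} ha hb i P => by
    obtain ⟨Q, hQ⟩ := ha i P
    obtain ⟨Q', hQ'⟩ := hb i P
    exact ⟨Q + Q', fun H hH => by rw [LinearMap.add_apply, hQ H hH, hQ' H hH, lc_add]⟩
  smul_mem' := fun r a ha i P => by
    obtain ⟨Q, hQ⟩ := ha i P
    exact ⟨r • Q, fun H hH => by rw [LinearMap.smul_apply, hQ H hH, lc_smul]⟩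

theorem Only_iter {i : ℕ} {H : Rl S} (h : Only i H) (j : ℕ) : Only i ((PD i)^[j] H) := by
  induction j with
  | zero => exact h
  | succ j ih => rw [Function.iterate_succ_apply']; exact ih.pd

theorem lc_shift (i j : ℕ) (Q : ℕ →₀ Rl S) (H : Rl S) :
    lc i Q ((PD i)^[j] H) = lc i (Q.mapDomain (· + j)) H := by
  induction Q using Finsupp.induction_linear with
  | zero => rw [Finsupp.mapDomain_zero, lc_zero, lc_zero]
  | add Q Q' h h' => rw [Finsupp.mapDomain_add, lc_add, lc_add, h, h']
  | single k c => rw [Finsupp.mapDomain_single, lc_single, lc_single, Function.iterate_add_apply]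

theorem LocS_lc {T : EE} (hT : T ∈ LocS) (i : ℕ) (Q : ℕ →₀ Rl S) :
    ∃ Q', ∀ H, Only i H → T (lc i Q H) = lc i Q' H := by
  induction Q using Finsupp.induction_linear with
  | zero => exact ⟨0, fun H _ => by rw [lc_zero, map_zero]⟩
  | add Q Q' h h' =>
    obtain ⟨R, hR⟩ := h
    obtain ⟨R', hR'⟩ := h'
    exact ⟨R + R', fun H hH => by rw [lc_add, map_add, hR H hH, hR' H hH, lc_add]⟩
  | single j c =>
    obtain ⟨R, hR⟩ := hT i c
    exact ⟨R.mapDomain (· + j), fun H hH => by rw [lc_single, hR _ (Only_iter hH j), lc_shift]⟩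

theorem LocS_mul {T U : EE} (hT : T ∈ LocS) (hU : U ∈ LocS) : T * U ∈ LocS := by
  intro i P
  obtain ⟨Q, hQ⟩ := hU i P
  obtain ⟨Q', hQ'⟩ := LocS_lc hT i Q
  exact ⟨Q', fun H hH => by
    change T (U (H * P)) = _
    rw [hQ H hH, hQ' H hH]⟩

theorem LocS_one : (1 : EE) ∈ LocS := fun i P =>
  ⟨Finsupp.single 0 P, fun H _ => by rw [lc_single]; rfl⟩

theorem LocS_XHL (x : Rl S) : XHL x ∈ LocS := fun i P =>
  ⟨Finsupp.single 0 (XH x P) + Finsupp.single 1 (P * XH x (uVar S i)), fun H hH => by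
    rw [lc_add, lc_single, lc_single, XHL_apply, Derivation.leibniz, XH_local x i H hH]
    simp only [smul_eq_mul, Function.iterate_zero, Function.iterate_one, id]
    ring⟩

theorem ComS_mul {T U : EE} (hT : T ∈ ComS) (hU : U ∈ ComS) : T * U ∈ ComS := by
  intro p
  change T (U (dxD p)) = dxD (T (U p))
  rw [hU p, hT]

theorem ComS_one : (1 : EE) ∈ ComS := fun _ => rfl

theorem ComS_XHL (x : Rl S) : XHL x ∈ ComS := fun p => XH_dx x p

theorem HomS_mul (i j : ℕ) (T U : EE) (hT : T ∈ HomS i) (hU : U ∈ HomS j) :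
    T * U ∈ HomS (i + j) := by
  intro d p hp
  have := hT _ _ (hU d p hp)
  rw [add_assoc, add_comm (j : ℤ)] at this
  exact_mod_cast this

theorem HomS_one : (1 : EE) ∈ HomS 0 := by
  intro d p hp
  simpa using hp

theorem HomS_XHL {n : ℕ} {x : Rl S} (hx : x ∈ Good n) : XHL x ∈ HomS n := by
  intro d p hp
  have := Good_XHL hx hp
  rwa [add_comm] at this

theorem PD_pow (i k j : ℕ) : (PD i)^[j] (uVar S i ^ k)
    = ((k.descFactorial j : ℝ)) • uVar S i ^ (k - j) := by
  induction j with
  | zero => simp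
  | succ j ih =>
    rw [Function.iterate_succ_apply', ih, Derivation.map_smul, Derivation.leibniz_pow, PD_uVar,
      if_pos rfl, smul_eq_mul, mul_one, ← Nat.cast_smul_eq_nsmul ℝ, smul_smul,
      Nat.descFactorial_succ, Nat.sub_sub]
    congr 1
    push_cast; ring

theorem Only_pow (i k : ℕ) : Only i (uVar S i ^ k) := fun l hl => by
  rw [Derivation.leibniz_pow, PD_uVar, if_neg hl, smul_zero, smul_zero]

theorem local_of_LocS (δ : Derivation ℝ (Rl S) (Rl S)) (h : (δ : Rl S →ₗ[ℝ] Rl S) ∈ LocS) :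
    IsLocalDer δ := by
  intro i
  obtain ⟨Q, hQ⟩ := h i 1
  have hQ2 : ∀ H, Only i H → δ H = lc i Q H := fun H hH => by
    have := hQ H hH
    rw [mul_one] at this
    exact this
  have key : ∀ k, Q k = if k = 1 then δ (uVar S i) else 0 := by
    intro k
    induction k using Nat.strong_induction_on with
    | _ k ih =>
      have h1 := hQ2 _ (Only_pow i k)
      rw [Derivation.leibniz_pow] at h1
      have h2 : lc i Q (uVar S i ^ k)
          = ∑ j ∈ Finset.range (k+1), ((k.descFactorial j : ℝ)) • (uVar S i ^ (k - j) * Q j) := by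
        rw [lc, Finsupp.sum_of_support_subset (s := Q.support ∪ Finset.range (k+1)) _
          Finset.subset_union_left _ (fun _ _ => mul_zero _)]
        symm
        refine Finset.sum_subset_zero_on_sdiff Finset.subset_union_right ?_ ?_
        · intro j hj
          have hj' := (Finset.mem_sdiff.mp hj).2
          rw [Finset.mem_range] at hj'
          rw [PD_pow, Nat.descFactorial_of_lt (by omega)]; simp
        · intro j _
          rw [PD_pow, smul_mul_assoc]
      rw [h2, Finset.sum_range_succ, Nat.descFactorial_self, Nat.sub_self, pow_zero, one_mul] at h1
      have hk : (k.factorial : ℝ) ≠ 0 := by exact_mod_cast k.factorial_ne_zero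
      have h3 : ∀ j ∈ Finset.range k, ((k.descFactorial j : ℝ)) • (uVar S i ^ (k - j) * Q j)
          = if j = 1 then (k : ℝ) • (uVar S i ^ (k - 1) * δ (uVar S i)) else 0 := by
        intro j hj
        rw [ih j (Finset.mem_range.mp hj)]
        split_ifs with h4
        · rw [h4, Nat.descFactorial_one]
        · rw [mul_zero, smul_zero]
      rw [Finset.sum_congr rfl h3, Finset.sum_ite_eq' , ← Nat.cast_smul_eq_nsmul ℝ, smul_eq_mul] at h1
      rcases lt_trichotomy k 1 with hk1 | hk1 | hk1
      · obtain rfl : k = 0 := by omega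
        simp at h1
        simpa using h1.symm
      · subst hk1
        simp at h1
        simpa using h1.symm
      · rw [if_pos (Finset.mem_range.mpr hk1)] at h1
        have h5 := left_eq_add.mp h1
        rw [if_neg (by omega)]
        exact (smul_eq_zero.mp h5).resolve_left hk
  intro H hH
  have : Q = Finsupp.single 1 (δ (uVar S i)) := by
    refine Finsupp.ext fun k => ?_
    rw [key, Finsupp.single_apply]
    simp only [eq_comm]
  rw [hQ2 H hH, this, lc_single, mul_comm]; rfl

theorem InBt_iff (Y : Ser S) : InBt S Y ↔ (∀ n : ℕ, Y n ∈ Good n) ∧ Y 0 = 0 := by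
  constructor
  · rintro ⟨h, h0⟩
    refine ⟨fun n m hm => ?_, h0⟩
    have hm' := Finsupp.mem_support_iff.mpr hm
    exact ⟨(h n).1.1 m hm', (h n).2 m hm'⟩
  · rintro ⟨h, h0⟩
    refine ⟨fun n => ⟨⟨fun m hm => ?_, fun m hm => ?_⟩, fun m hm => ?_⟩, h0⟩
    · exact (h n m (Finsupp.mem_support_iff.mp hm)).1
    · rw [(h n m (Finsupp.mem_support_iff.mp hm)).2]; exact Int.natCast_nonneg _
    · exact (h n m (Finsupp.mem_support_iff.mp hm)).2

theorem fux_good (f : SF S) : fux S f ∈ Good 1 := by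
  rw [fux_single]; exact single_mem_SupM _ fun _ => ⟨rfl, wtM_z 1⟩

theorem bfield_good (f : SF S) (n : ℕ) : bfield S f n ∈ Good n := by
  rw [bfield]
  split_ifs with h
  · rw [h]; exact fux_good f
  · exact Submodule.zero_mem _

theorem evX_good (f : SF S) (Xi : ℕ → Rl S)
    (hXi : ∀ i, 3 ≤ i → InR S (Xi i) ∧ IsHomog S (i:ℤ) (Xi i)) (n : ℕ) : evX f Xi n ∈ Good n := by
  rw [evX]
  split_ifs with h h3
  · rw [h]; exact fux_good f
  · intro m hm
    have hm' := Finsupp.mem_support_iff.mpr hm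
    exact ⟨(hXi n h3).1.1 m hm', (hXi n h3).2 m hm'⟩
  · exact Submodule.zero_mem _

theorem brk_good {Y U : Ser S} (hY : ∀ n : ℕ, Y n ∈ Good n) (hU : ∀ n : ℕ, U n ∈ Good n) (n : ℕ) :
    brk S hS Y U n ∈ Good n := by
  rw [brk_eq]
  refine Submodule.sum_mem _ fun p hp => ?_
  have := Good_br (hY p.1) (hU p.2)
  rwa [← Nat.cast_add, Finset.HasAntidiagonal.mem_antidiagonal.mp hp] at this

theorem gV_good {Y U : Ser S} (hY : ∀ n : ℕ, Y n ∈ Good n) (hU : ∀ n : ℕ, U n ∈ Good n) (n : ℕ) :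
    gV S hS Y U n ∈ Good n := by
  have h : ∀ m, ∀ n : ℕ, (brk S hS Y)^[m] U n ∈ Good n := by
    intro m
    induction m with
    | zero => exact hU
    | succ m ih => intro n; rw [Function.iterate_succ_apply']; exact brk_good hY ih n
  exact Submodule.sum_mem _ fun m _ => Submodule.smul_mem _ _ (h m n)

theorem br_zero_left (y : Rl S) : br 0 y = 0 := by
  rw [br, map_zero, map_zero]; simp

theorem br_zero_right (y : Rl S) : br y 0 = 0 := by
  rw [br, map_zero, map_zero]; simp

theorem gV_of_brk_zero {Y W : Ser S} (h : brk S hS Y W = 0) : gV S hS Y W = W := by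
  have h0 : brk S hS Y 0 = 0 := by
    funext n
    rw [brk_eq]
    exact Finset.sum_eq_zero fun p _ => br_zero_right _
  have h1 : ∀ m, (brk S hS Y)^[m+1] W = 0 := by
    intro m
    induction m with
    | zero => exact h
    | succ m ih => rw [Function.iterate_succ_apply', ih, h0]
  funext n
  rw [gV, Finset.sum_range_succ', Finset.sum_eq_zero]
  · simp
  · intro m _
    rw [h1]; exact smul_zero _

theorem gV_zero_left (W : Ser S) : gV S hS 0 W = W := by
  apply gV_of_brk_zero
  funext n
  rw [brk_eq]
  exact Finset.sum_eq_zero fun p _ => br_zero_left _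

theorem gV_bfield (p f : SF S) : gV S hS (bfield S p) (bfield S f) = bfield S f := by
  apply gV_of_brk_zero
  funext n
  rw [brk_eq]
  refine Finset.sum_eq_zero fun q _ => ?_
  rw [bfield, bfield]
  split_ifs
  · exact br_fux _ _
  · exact br_zero_right _
  · exact br_zero_left _
  · exact br_zero_left _

theorem brk_vanish {Y U : Ser S} (hY : Y 0 = 0) (hU : U 0 = 0) :
    brk S hS Y U 0 = 0 ∧ brk S hS Y U 1 = 0 := by
  constructor
  · rw [brk_eq]
    simp [hY, br_zero_left]
  · rw [brk_eq]
    refine Finset.sum_eq_zero fun p hp => ?_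
    have := Finset.HasAntidiagonal.mem_antidiagonal.mp hp
    by_cases h : p.1 = 0
    · rw [h, hY, br_zero_left]
    · have h2 : p.2 = 0 := by omega
      rw [h2, hU, br_zero_right]

theorem seq_vanish {Y X : Ser S} {a : ℕ → Ser S} (hY : Y 0 = 0) (hX : X 0 = 0)
    (a0 : a 0 = X) (as : ∀ m, a (m+1) = brk S hS Y (a m)) (m : ℕ) : a m 0 = 0 := by
  induction m with
  | zero => rw [a0]; exact hX
  | succ m ih => rw [as]; exact (brk_vanish hY ih).1

theorem seq_vanish_one {Y X : Ser S} {a : ℕ → Ser S} (hY : Y 0 = 0) (hX : X 0 = 0)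
    (a0 : a 0 = X) (as : ∀ m, a (m+1) = brk S hS Y (a m)) (m : ℕ) : a (m+1) 1 = 0 := by
  rw [as]; exact (brk_vanish hY (seq_vanish hY hX a0 as m)).2

theorem seq_eq {Y Y' X : Ser S} {a b : ℕ → Ser S} (n : ℕ) (hY : Y 0 = 0) (hY' : Y' 0 = 0)
    (hX : X 0 = 0) (h : ∀ k, k < n → Y k = Y' k)
    (a0 : a 0 = X) (as : ∀ m, a (m+1) = brk S hS Y (a m))
    (b0 : b 0 = X) (bs : ∀ m, b (m+1) = brk S hS Y' (b m)) (m : ℕ) :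
    ∀ k, k ≤ n → a m k = b m k := by
  induction m with
  | zero => intro k _; rw [a0, b0]
  | succ m ih =>
    intro k hk
    rw [as, bs, brk_eq, brk_eq]
    refine Finset.sum_congr rfl fun p hp => ?_
    have := Finset.HasAntidiagonal.mem_antidiagonal.mp hp
    by_cases h2 : p.2 = 0
    · rw [h2, seq_vanish hY hX a0 as, seq_vanish hY' hX b0 bs, br_zero_right, br_zero_right]
    · rw [ih p.2 (by omega), h p.1 (by omega)]

theorem seq_eq_two {Y Y' X : Ser S} {a b : ℕ → Ser S} (n : ℕ) (hY : Y 0 = 0) (hY' : Y' 0 = 0)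
    (hX : X 0 = 0) (h : ∀ k, k < n → Y k = Y' k)
    (a0 : a 0 = X) (as : ∀ m, a (m+1) = brk S hS Y (a m))
    (b0 : b 0 = X) (bs : ∀ m, b (m+1) = brk S hS Y' (b m)) (m : ℕ) :
    a (m+1+1) (n+1) = b (m+1+1) (n+1) := by
  rw [as (m+1), bs (m+1), brk_eq, brk_eq]
  refine Finset.sum_congr rfl fun p hp => ?_
  have := Finset.HasAntidiagonal.mem_antidiagonal.mp hp
  by_cases h2 : p.2 = 0
  · rw [h2, seq_vanish hY hX a0 as, seq_vanish hY' hX b0 bs, br_zero_right, br_zero_right]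
  by_cases h3 : p.2 = 1
  · rw [h3, seq_vanish_one hY hX a0 as, seq_vanish_one hY' hX b0 bs, br_zero_right, br_zero_right]
  by_cases h4 : p.1 = 0
  · rw [h4, hY, hY', br_zero_left, br_zero_left]
  · rw [seq_eq n hY hY' hX h a0 as b0 bs _ p.2 (by omega), h p.1 (by omega)]

theorem brk_incr {Y Y' X : Ser S} (n : ℕ) (hX : X 0 = 0) (h : ∀ k, k < n → Y k = Y' k) :
    brk S hS Y X (n+1) = br (Y n - Y' n) (X 1) + brk S hS Y' X (n+1) := by
  rw [brk_eq, brk_eq]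
  have hmem : (n, 1) ∈ Finset.HasAntidiagonal.antidiagonal (n+1) :=
    Finset.HasAntidiagonal.mem_antidiagonal.mpr rfl
  rw [← Finset.add_sum_erase _ _ hmem,
    ← Finset.add_sum_erase (Finset.HasAntidiagonal.antidiagonal (n+1))
      (fun p : ℕ × ℕ => br (Y' p.1) (X p.2)) hmem, ← add_assoc,
    br_sub_left, sub_add_cancel]
  congr 1
  refine Finset.sum_congr rfl fun p hp => ?_
  rw [Finset.mem_erase] at hp
  have := Finset.HasAntidiagonal.mem_antidiagonal.mp hp.2
  by_cases h2 : p.2 = 0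
  · rw [h2, hX, br_zero_right, br_zero_right]
  · by_cases h3 : p.2 = 1
    · exfalso; exact hp.1 (Prod.ext (by change p.1 = n; omega) h3)
    · rw [h p.1 (by omega)]

theorem sum_incr {A : Type*} [AddCommGroup A] [Module ℝ A] (a b : ℕ → A) (n : ℕ) (c : A)
    (h0 : a 0 = b 0) (h1 : a 1 = c + b 1) (h2 : ∀ m, a (m+1+1) = b (m+1+1)) :
    ∑ m ∈ Finset.range (n+1+1), ((m.factorial : ℝ)⁻¹) • a m
     = c + ∑ m ∈ Finset.range (n+1+1), ((m.factorial : ℝ)⁻¹) • b m := by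
  simp only [Finset.sum_range_succ' _ (n+1), Finset.sum_range_succ' _ n, h2, h0, zero_add, h1,
    Nat.factorial_one, Nat.factorial_zero, Nat.cast_one, inv_one, one_smul]
  abel

theorem increment {Y Y' X : Ser S} (n : ℕ) (hY : Y 0 = 0) (hY' : Y' 0 = 0)
    (hX : X 0 = 0) (h : ∀ k, k < n → Y k = Y' k) :
    gV S hS Y X (n+1) - gV S hS Y' X (n+1) = br (Y n - Y' n) (X 1) := by
  have key : ∀ Y : Ser S, ∃ a : ℕ → Ser S, a 0 = X ∧ (∀ m, a (m+1) = brk S hS Y (a m)) ∧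
      gV S hS Y X (n+1) = ∑ m ∈ Finset.range (n+1+1), ((m.factorial : ℝ)⁻¹) • a m (n+1) :=
    fun Y => ⟨fun m => (brk S hS Y)^[m] X, rfl,
      fun m => Function.iterate_succ_apply' _ _ _, rfl⟩
  obtain ⟨a, a0, as, ha⟩ := key Y
  obtain ⟨b, b0, bs, hb⟩ := key Y'
  rw [sub_eq_iff_eq_add, ha, hb]
  refine sum_incr (fun m => a m (n+1)) (fun m => b m (n+1)) n _ ?_ ?_ ?_
  · beta_reduce
    rw [a0, b0]
  · beta_reduce
    rw [show a 1 = brk S hS Y (a 0) from as 0, show b 1 = brk S hS Y' (b 0) from bs 0, a0, b0]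
    exact brk_incr n hX h
  · intro m
    exact seq_eq_two n hY hY' hX h a0 as b0 bs m

/-- a chosen solution of the linearised equation -/
def sol (f : SF S) (d : ℕ) (g : Rl S) : Rl S :=
  if h : ∃ y ∈ Good d, br y (fux S f) = g then h.choose else 0

theorem sol_good (f : SF S) (d : ℕ) (g : Rl S) : sol f d g ∈ Good d := by
  rw [sol]
  split_ifs with h
  · exact h.choose_spec.1
  · exact Submodule.zero_mem _

theorem sol_eq (f : SF S) (hf : ∀ x, (dSF S hS f : ℝ → ℝ) x ≠ 0) (d : ℕ) (hd : 2 ≤ d) (g : Rl S)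
    (hg : g ∈ Good (d + 1 : ℕ)) : br (sol f d g) (fux S f) = g := by
  have h : ∃ y ∈ Good d, br y (fux S f) = g :=
    solve f hf d (by exact_mod_cast hd) g (by exact_mod_cast hg)
  rw [sol, dif_pos h]
  exact h.choose_spec.2

/-- the reducing transformation -/
def Yrec (f : SF S) (X : Ser S) (n : ℕ) : Rl S :=
  if 2 ≤ n then sol f n (- gV S hS (fun k => if _h : k < n then Yrec f X k else 0) X (n+1)) else 0
termination_by n
decreasing_by exact _h

theorem Yrec_good (f : SF S) (X : Ser S) (n : ℕ) : Yrec f X n ∈ Good n := by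
  rw [Yrec]
  split_ifs
  · exact sol_good _ _ _
  · exact Submodule.zero_mem _

theorem Yrec_lt (f : SF S) (X : Ser S) (n : ℕ) (h : n < 2) : Yrec f X n = 0 := by
  rw [Yrec, if_neg (by omega)]

theorem Good_neg {d : ℤ} {x : Rl S} (h : x ∈ Good d) : -x ∈ Good d := by
  have := SupM_sub (Submodule.zero_mem (Good d)) h
  have e : (0:Rl S) - x = -x := by
    rw [sub_eq_iff_eq_add]; exact (neg_add_cancel x).symm
  rw [e] at this
  exact this

theorem ser_ge_two {X Y : Ser S} (h0 : X 0 = Y 0) (h1 : X 1 = Y 1) (h2 : X 2 = Y 2)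
    (h : ∀ n, 2 ≤ n → X (n+1) = Y (n+1)) : X = Y := by
  funext n
  match n with
  | 0 => exact h0
  | 1 => exact h1
  | 2 => exact h2
  | (n+3) => exact h (n+2) (by omega)

theorem gV_zero_idx (Y X : Ser S) : gV S hS Y X 0 = X 0 := by
  rw [gV]; simp

theorem Yrec_spec (f : SF S) (hf : ∀ x, (dSF S hS f : ℝ → ℝ) x ≠ 0) (X : Ser S)
    (hX : ∀ n : ℕ, X n ∈ Good n) (h0 : X 0 = 0) (h1 : X 1 = fux S f) (h2 : X 2 = 0) :
    gV S hS (Yrec f X) X = bfield S f := by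
  have hz : (0 : Ser S) 0 = 0 := rfl
  refine ser_ge_two ?_ ?_ ?_ ?_
  · rw [gV_zero_idx, h0]; rfl
  · have := increment (Y := Yrec f X) (Y' := 0) (X := X) 0 (Yrec_lt _ _ _ (by omega)) hz h0
      (fun k hk => by omega)
    rw [Yrec_lt _ _ _ (by omega), hz, sub_self, br_zero_left, gV_zero_left] at this
    rw [sub_eq_zero.mp this, zero_add, h1]; rfl
  · have := increment (Y := Yrec f X) (Y' := 0) (X := X) 1 (Yrec_lt _ _ _ (by omega)) hz h0
      (fun k hk => by
        obtain rfl : k = 0 := by omega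
        rw [Yrec_lt _ _ _ (by omega)]; rfl)
    rw [Yrec_lt _ _ _ (by omega), Pi.zero_apply, sub_self, br_zero_left, gV_zero_left] at this
    rw [sub_eq_zero.mp this]
    exact h2
  · intro n hn
    have hT : ∀ k : ℕ, (fun k => if _h : k < n then Yrec f X k else 0 : Ser S) k ∈ Good k := by
      intro k
      dsimp only
      split_ifs
      · exact Yrec_good f X k
      · exact Submodule.zero_mem _
    have hi := increment (Y := Yrec f X) (Y' := fun k => if _h : k < n then Yrec f X k else 0)
      (X := X) n (Yrec_lt _ _ _ (by omega))
      (by rw [dif_pos (by omega), Yrec_lt _ _ _ (by omega)]) h0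
      (fun k hk => by rw [dif_pos hk])
    have e : Yrec f X n - 0 = Yrec f X n := by
      rw [sub_eq_iff_eq_add, add_zero]
    rw [dif_neg (lt_irrefl n), e, h1] at hi
    conv at hi => rhs; rw [Yrec, if_pos hn]
    rw [sol_eq f hf n hn _ (Good_neg (gV_good hT hX (n+1)))] at hi
    have hb : bfield S f (n+1) = 0 := if_neg (by omega)
    rw [hb]
    have := sub_eq_iff_eq_add.mp hi
    rw [this]; exact neg_add_cancel _

theorem int_diff {A : Type*} [Ring A] {φ ψ f x : PowerSeries A}
    (hf : ∀ k, k ≠ 1 → PowerSeries.coeff k f = 0) (hx : PowerSeries.coeff 0 x = 0)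
    (h1 : f * φ = φ * x) (h2 : f * ψ = ψ * x) (n : ℕ)
    (ih : ∀ k, k < n → PowerSeries.coeff k φ = PowerSeries.coeff k ψ) :
    PowerSeries.coeff 1 f * (PowerSeries.coeff n φ - PowerSeries.coeff n ψ)
      = (PowerSeries.coeff n φ - PowerSeries.coeff n ψ) * PowerSeries.coeff 1 x := by
  have h3 : f * (φ - ψ) = (φ - ψ) * x := by rw [mul_sub, sub_mul, h1, h2]
  have hD : ∀ k, k < n → PowerSeries.coeff k (φ - ψ) = 0 := fun k hk => by
    rw [map_sub, ih k hk, sub_self]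
  rw [← map_sub]
  have h4 := congrArg (PowerSeries.coeff (n+1)) h3
  rw [PowerSeries.coeff_mul, PowerSeries.coeff_mul, Finset.sum_eq_single (1, n),
    Finset.sum_eq_single (n, 1)] at h4
  · exact h4
  · intro p hp hne
    have := Finset.HasAntidiagonal.mem_antidiagonal.mp hp
    by_cases h : p.2 = 0
    · rw [h, hx, mul_zero]
    · have h' : p.1 ≠ n := fun h' => hne (Prod.ext h' (by change p.2 = 1; omega))
      rw [hD p.1 (by omega), zero_mul]
  · intro h
    exact absurd (Finset.HasAntidiagonal.mem_antidiagonal.mpr (by change n + 1 = n + 1; rfl)) h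
  · intro p hp hne
    have := Finset.HasAntidiagonal.mem_antidiagonal.mp hp
    have h' : p.1 ≠ 1 := fun h' => hne (Prod.ext h' (by change p.2 = n; omega))
    rw [hf p.1 h', zero_mul]
  · intro h
    exact absurd (Finset.HasAntidiagonal.mem_antidiagonal.mpr (by change 1 + n = n + 1; omega)) h

theorem diff_leib {a b : PowerSeries EE} (ha : Mlt a) (hb : Mlt b)
    (a0 : PowerSeries.coeff 0 a = 1) (b0 : PowerSeries.coeff 0 b = 1) (n : ℕ)
    (ih : ∀ k, k < n + 1 → PowerSeries.coeff k a = PowerSeries.coeff k b) (f g : Rl S) :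
    (PowerSeries.coeff (n+1) a - PowerSeries.coeff (n+1) b) (f * g)
      = f * (PowerSeries.coeff (n+1) a - PowerSeries.coeff (n+1) b) g
        + g * (PowerSeries.coeff (n+1) a - PowerSeries.coeff (n+1) b) f := by
  have key : ∀ c : PowerSeries EE, Mlt c → PowerSeries.coeff 0 c = 1 → 
      (∀ k, k < n + 1 → PowerSeries.coeff k c = PowerSeries.coeff k b) →
      PowerSeries.coeff (n+1) c (f * g) = f * PowerSeries.coeff (n+1) c g
        + PowerSeries.coeff (n+1) c f * g
        + ∑ p ∈ (Finset.HasAntidiagonal.antidiagonal (n+1)).filter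
            (fun p => p.1 ≠ 0 ∧ p.2 ≠ 0),
          PowerSeries.coeff p.1 b f * PowerSeries.coeff p.2 b g := by
    intro c hc c0 hcb
    rw [Mlt_coeff hc, ← Finset.sum_filter_add_sum_filter_not _ (fun p : ℕ × ℕ => p.1 ≠ 0 ∧ p.2 ≠ 0),
      add_comm]
    have e : (Finset.HasAntidiagonal.antidiagonal (n+1)).filter
        (fun p : ℕ × ℕ => ¬ (p.1 ≠ 0 ∧ p.2 ≠ 0)) = {(0, n+1), (n+1, 0)} := by
      ext p
      rw [Finset.mem_filter, Finset.HasAntidiagonal.mem_antidiagonal, Finset.mem_insert,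
        Finset.mem_singleton, Prod.ext_iff, Prod.ext_iff]
      dsimp only
      omega
    rw [e, Finset.sum_pair (fun h => by have := congrArg Prod.fst h; dsimp only at this; omega), c0]
    congr 1
    refine Finset.sum_congr rfl fun p hp => ?_
    rw [Finset.mem_filter, Finset.HasAntidiagonal.mem_antidiagonal] at hp
    rw [hcb p.1 (by omega), hcb p.2 (by omega)]
  rw [End_sub_apply, End_sub_apply, End_sub_apply, key a ha a0 ih, key b hb b0 fun _ _ => rfl]
  ring

theorem GrC_expS (P : Submodule ℝ EE) (h1 : (1:EE) ∈ P) (hP : ∀ x y : EE, x ∈ P → y ∈ P → x * y ∈ P)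
    (hX : ∀ x, XHL x ∈ P) (Y : Ser S) : GrS (fun _ => P) (expS (hat Y)) :=
  GrS_expS h1 (fun _ _ x y => hP x y) fun n => by rw [coeff_hat]; exact hX _

theorem GrH_expS (Y : Ser S) (hY : ∀ n : ℕ, Y n ∈ Good n) : GrS HomS (expS (hat Y)) :=
  GrS_expS HomS_one HomS_mul fun n => by rw [coeff_hat]; exact HomS_XHL (hY n)

theorem EE_sub_mem (P : Submodule ℝ EE) {x y : EE} (hx : x ∈ P) (hy : y ∈ P) : x - y ∈ P := by
  have h : x - y = x + (-1:ℝ) • y := by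
    refine LinearMap.ext fun p => ?_
    rw [End_sub_apply, sub_eq_iff_eq_add, LinearMap.add_apply, LinearMap.smul_apply, add_assoc]
    have : (-1:ℝ) • y p + y p = 0 := by
      nth_rewrite 2 [← one_smul ℝ (y p)]
      rw [← add_smul]; norm_num
    rw [this, add_zero]
  rw [h]
  exact P.add_mem hx (P.smul_mem _ hy)

theorem step_zero (f : SF S) (hf : ∀ x, (dSF S hS f : ℝ → ℝ) x ≠ 0) (n : ℕ) (hn : 2 ≤ n) (χ : EE)
    (hl : ∀ a b, χ (a * b) = a * χ b + b * χ a) (hloc : χ ∈ LocS) (hcom : χ ∈ ComS)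
    (hhom : χ ∈ HomS n) (hc : XHL (fux S f) * χ = χ * XHL (fux S f)) : χ = 0 := by
  let δ : Derivation ℝ (Rl S) (Rl S) := 
    { toLinearMap := χ
      map_one_eq_zero' := by
        have := hl 1 1
        rw [one_mul, one_mul] at this
        exact left_eq_add.mp this
      leibniz' := fun a b => hl a b }
  have hδ : δ = XH (δ (uVar S 0)) := eq_XH δ (local_of_LocS δ hloc) hcom
  set V := χ (uVar S 0) with hV
  have e : χ = XHL V := by
    refine LinearMap.ext fun p => ?_
    exact congrArg (fun d : Derivation ℝ (Rl S) (Rl S) => d p) hδ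
  have hg : V ∈ Good (n:ℤ) := by
    have := hhom _ _ (Good_uVar 0)
    rwa [Nat.cast_zero, zero_add] at this
  have hb : br V (fux S f) = 0 := by
    apply XHL_inj
    rw [XHL_br, ← e, hc, map_zero, sub_self]
  rw [e, ker2 f hf n (by exact_mod_cast hn) V hg hb, map_zero]

theorem hat_bfield_ne (f : SF S) (k : ℕ) (hk : k ≠ 1) :
    PowerSeries.coeff k (hat (bfield S f)) = 0 := by
  rw [coeff_hat, bfield, if_neg hk, map_zero]

theorem bfield_one (f : SF S) : bfield S f 1 = fux S f := by
  rw [bfield, if_pos rfl]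

theorem bfield_zero (f : SF S) : bfield S f 0 = 0 := by
  rw [bfield, if_neg (by omega)]

theorem bfield_two (f : SF S) : bfield S f 2 = 0 := by
  rw [bfield, if_neg (by omega)]

theorem coeff_one_mul' {A : Type*} [Ring A] {a b : PowerSeries A} (ha : PowerSeries.coeff 0 a = 1)
    (hb : PowerSeries.coeff 0 b = 1) : PowerSeries.coeff 1 (a * b)
      = PowerSeries.coeff 1 a + PowerSeries.coeff 1 b := by
  rw [PowerSeries.coeff_mul, Finset.Nat.sum_antidiagonal_eq_sum_range_succ_mk,
    Finset.sum_range_succ, Finset.sum_range_one, ha, hb, one_mul, mul_one, add_comm]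

theorem coeff_zero_mul' {A : Type*} [Ring A] {a b : PowerSeries A} (ha : PowerSeries.coeff 0 a = 1)
    (hb : PowerSeries.coeff 0 b = 1) : PowerSeries.coeff 0 (a * b) = 1 := by
  rw [PowerSeries.coeff_mul, Finset.Nat.sum_antidiagonal_eq_sum_range_succ_mk,
    Finset.sum_range_one, ha, hb, one_mul]

theorem factor (f : SF S) (hf : ∀ x, (dSF S hS f : ℝ → ℝ) x ≠ 0) (X : Ser S)
    (h0 : X 0 = 0) (h1 : X 1 = fux S f)
    (Y Z : Ser S) (hY : ∀ n : ℕ, Y n ∈ Good n) (hZ : ∀ n : ℕ, Z n ∈ Good n)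
    (hY0 : Y 0 = 0) (hZ0 : Z 0 = 0) (hY1 : Y 1 = 0) (p : SF S) (hZ1 : Z 1 = fux S p)
    (hYX : gV S hS Y X = bfield S f) (hZX : gV S hS Z X = bfield S f) :
    expS (hat Z) = expS (hat (bfield S p)) * expS (hat Y) := by
  have hB0 := bfield_zero p
  have iZ := gV_intertwine Z X hZ0
  have iY := gV_intertwine Y X hY0
  have iB := gV_intertwine (bfield S p) (bfield S f) hB0
  rw [hZX] at iZ
  rw [hYX] at iY
  rw [gV_bfield] at iB
  have mZ := Mlt_expS Z hZ0
  have mP := Mlt_mul (Mlt_expS _ hB0) (Mlt_expS Y hY0)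
  have cP := coeff_zero_mul' (coeff_zero_expS (hat (bfield S p))) (coeff_zero_expS (hat Y))
  have cP1 := coeff_one_mul' (coeff_zero_expS (hat (bfield S p))) (coeff_zero_expS (hat Y))
  have gr : ∀ P : Submodule ℝ EE, (1:EE) ∈ P → (∀ x y : EE, x ∈ P → y ∈ P → x * y ∈ P) →
      (∀ x, XHL x ∈ P) → ∀ n, PowerSeries.coeff n (expS (hat Z))
        - PowerSeries.coeff n (expS (hat (bfield S p)) * expS (hat Y)) ∈ P := by
    intro P p1 p2 p3 n
    exact EE_sub_mem P (GrC_expS P p1 p2 p3 Z n)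
      (GrS_mul (P := fun _ => P) (fun _ _ x y => p2 x y) (GrC_expS P p1 p2 p3 _)
        (GrC_expS P p1 p2 p3 Y) n)
  have gh : ∀ n, PowerSeries.coeff n (expS (hat Z))
        - PowerSeries.coeff n (expS (hat (bfield S p)) * expS (hat Y)) ∈ HomS n := fun n =>
    EE_sub_mem _ (GrH_expS Z hZ n)
      (GrS_mul HomS_mul (GrH_expS _ (bfield_good p)) (GrH_expS Y hY) n)
  have iP : hat (bfield S f) * (expS (hat (bfield S p)) * expS (hat Y))
      = (expS (hat (bfield S p)) * expS (hat Y)) * hat X := by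
    rw [← mul_assoc, iB, mul_assoc, iY, mul_assoc]
  refine PowerSeries.ext fun n => ?_
  induction n using Nat.strong_induction_on with
  | _ n ih =>
    match n, ih with
    | 0, _ => rw [coeff_zero_expS, cP]
    | 1, _ =>
      rw [cP1, coeff_one_expS, coeff_one_expS, coeff_one_expS, coeff_hat, coeff_hat, coeff_hat,
        hY1, hZ1, bfield_one, map_zero, add_zero]
    | (n+2), ih =>
      have hc := int_diff (hat_bfield_ne f) (by rw [coeff_hat, h0, map_zero]) iZ iP (n+2) ih
      rw [coeff_hat, coeff_hat, bfield_one, h1] at hc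
      exact sub_eq_zero.mp (step_zero f hf (n+2) (by omega) _
        (diff_leib mZ mP (coeff_zero_expS _) cP (n+1) ih)
        (gr LocS LocS_one (fun _ _ => LocS_mul) LocS_XHL _)
        (gr ComS ComS_one (fun _ _ => ComS_mul) ComS_XHL _) (gh _) hc)

theorem factor_gV (Y Z : Ser S) (hY0 : Y 0 = 0) (hZ0 : Z 0 = 0) (p : SF S)
    (h : expS (hat Z) = expS (hat (bfield S p)) * expS (hat Y)) (W : Ser S) :
    gV S hS Z W = gV S hS (bfield S p) (gV S hS Y W) := by
  apply hat_inj
  apply cancel_right (coeff_zero_expS (hat Z))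
  rw [gV_intertwine Z W hZ0, h, ← mul_assoc, gV_intertwine _ _ (bfield_zero p), mul_assoc,
    mul_assoc, gV_intertwine Y W hY0]

theorem uniq (f : SF S) (hf : ∀ x, (dSF S hS f : ℝ → ℝ) x ≠ 0) (X : Ser S)
    (h0 : X 0 = 0) (h1 : X 1 = fux S f)
    (Y Z : Ser S) (hY : ∀ n : ℕ, Y n ∈ Good n) (hZ : ∀ n : ℕ, Z n ∈ Good n)
    (hY0 : Y 0 = 0) (hZ0 : Z 0 = 0) (hY1 : Y 1 = 0) (hZ1 : Z 1 = 0)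
    (hYX : gV S hS Y X = bfield S f) (hZX : gV S hS Z X = bfield S f) : Z = Y := by
  funext n
  induction n using Nat.strong_induction_on with
  | _ n ih =>
    match n, ih with
    | 0, _ => rw [hY0, hZ0]
    | 1, _ => rw [hY1, hZ1]
    | (n+2), ih =>
      have hi := increment (n+2) hZ0 hY0 h0 ih
      rw [hYX, hZX, sub_self, h1] at hi
      exact sub_eq_zero.mp (ker2 f hf ((n+2 : ℕ) : ℤ) (by push_cast; omega) _
        (SupM_sub (hZ (n+2)) (hY (n+2))) hi.symm)

theorem first_coeff (f : SF S) (hf : ∀ x, (dSF S hS f : ℝ → ℝ) x ≠ 0) (X : Ser S)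
    (h0 : X 0 = 0) (h1 : X 1 = fux S f) (h2 : X 2 = 0)
    (Z : Ser S) (hZ : ∀ n : ℕ, Z n ∈ Good n) (hZ0 : Z 0 = 0)
    (hZX : gV S hS Z X = bfield S f) : ∃ p, Z 1 = fux S p := by
  have hi := increment (Y := Z) (Y' := 0) 1 hZ0 rfl h0 (fun k hk => by
    obtain rfl : k = 0 := by omega
    rw [hZ0]; rfl)
  rw [hZX, gV_zero_left, bfield_two, h2, sub_self, h1] at hi
  have e : Z 1 - (0 : Ser S) 1 = Z 1 := by
    rw [sub_eq_iff_eq_add, Pi.zero_apply, add_zero]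
  rw [e] at hi
  exact ker1 f hf (Z 1) (hZ 1) hi.symm


/-- For an evolutionary PDE `X = ε f(u)uₓ + ∑_{i≥3} εⁱ Xᵢ`, `f'(u) ≠ 0`, there is a
unique `Y ∈ ℬ̃` of the form `Y = ∑_{i≥2} εⁱ Yᵢ` with `g_Y(X) = ε f(u)uₓ`; any other
reducing transformation `g_Z` is `g_{Ỹ} ∘ g_Y` with `Ỹ = ε p(u)uₓ`. -/
theorem weak_quasi_triviality
    (f : SF S) (hf : ∀ x, (dSF S hS f : ℝ → ℝ) x ≠ 0)
    (Xi : ℕ → Rl S)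
    (hXi : ∀ i, 3 ≤ i → InR S (Xi i) ∧ IsHomog S (i:ℤ) (Xi i)) :
    ∃ Y : Ser S,
      (InBt S Y ∧ Y 1 = 0 ∧ gV S hS Y (evX f Xi) = bfield S f) ∧
      (∀ Y' : Ser S, InBt S Y' → Y' 1 = 0 → gV S hS Y' (evX f Xi) = bfield S f → Y' = Y) ∧
      (∀ Z : Ser S, InBt S Z → gV S hS Z (evX f Xi) = bfield S f →
        ∃ p : SF S, ∀ W : Ser S,
          gV S hS Z W = gV S hS (bfield S p) (gV S hS Y W)) := by
  have hX := evX_good f Xi hXi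
  have h0 : evX f Xi 0 = 0 := by rw [evX, if_neg (by omega), if_neg (by omega)]
  have h1 : evX f Xi 1 = fux S f := by rw [evX, if_pos rfl]
  have h2 : evX f Xi 2 = 0 := by rw [evX, if_neg (by omega), if_neg (by omega)]
  have hYg := Yrec_good f (evX f Xi)
  have hY0 := Yrec_lt f (evX f Xi) 0 (by omega)
  have hY1 := Yrec_lt f (evX f Xi) 1 (by omega)
  have hYX := Yrec_spec f hf (evX f Xi) hX h0 h1 h2
  refine ⟨Yrec f (evX f Xi), ⟨(InBt_iff _).mpr ⟨hYg, hY0⟩, hY1, hYX⟩, ?_, ?_⟩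
  · intro Y' hB hB1 hE
    obtain ⟨hg, hg0⟩ := (InBt_iff _).mp hB
    exact uniq f hf _ h0 h1 _ _ hYg hg hY0 hg0 hY1 hB1 hYX hE
  · intro Z hB hE
    obtain ⟨hg, hg0⟩ := (InBt_iff _).mp hB
    obtain ⟨p, hp⟩ := first_coeff f hf _ h0 h1 h2 Z hg hg0 hE
    exact ⟨p, factor_gV _ _ hY0 hg0 p
      (factor f hf _ h0 h1 _ Z hYg hg hY0 hg0 hY1 p hp hYX hE)⟩

end
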